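/- arXiv:0710.2340 — 7 statements merged into one kernel-verified Lean document; each statement's English description precedes it below -/
import Mathlib

section
/- Let F be a totally real number field. Suppose that to each real embedding σ : F → ℝ an interval [a_σ, b_σ] ⊂ ℝ is assigned such that ∏_σ (b_σ − a_σ)/4 < 1. Fix a natural number m and intervals [s_1, t_1], …, [s_m, t_m] in ℝ. Then there exists a constant N (depending only on F, the intervals [a_σ, b_σ], and the intervals [s_i, t_i]) with the following property: if α is a totally real algebraic integer and there are m pairwise distinct real embeddings τ_1, …, τ_m : F(α) → ℝ with s_i ≤ τ_i(α) ≤ t_i for i = 1, …, m, while every other real embedding τ : F(α) → ℝ satisfies a_{τ|F} ≤ τ(α) ≤ b_{τ|F} (where τ|F denotes the restriction of τ to F), then [F(α) : F] ≤ N. -/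
open Polynomial in
/-- Growth bound for the Chebyshev polynomials of the first kind on `[-R, R]`. -/
theorem abs_eval_chebyshevT_le {R x : ℝ} (hR : 1 ≤ R) (hx : |x| ≤ R) (j : ℕ) :
    |(Chebyshev.T ℝ j).eval x| ≤ (3 * R) ^ j := by
  induction j using Nat.twoStepInduction with
  | zero => simp
  | one => simp; linarith
  | more j h₀ h₁ =>
    have hrec : (Chebyshev.T ℝ ((j + 2 : ℕ) : ℤ)).eval x =
        2 * x * (Chebyshev.T ℝ ((j + 1 : ℕ) : ℤ)).eval x - (Chebyshev.T ℝ (j : ℤ)).eval x := by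
      push_cast
      rw [Chebyshev.T_add_two]
      simp
    have hpos : 0 < (3 * R) ^ j := by positivity
    calc _ ≤ |2 * x * (Chebyshev.T ℝ ((j + 1 : ℕ) : ℤ)).eval x| +
          |(Chebyshev.T ℝ (j : ℤ)).eval x| := by rw [hrec]; exact abs_sub _ _
      _ ≤ 2 * R * (3 * R) ^ (j + 1) + (3 * R) ^ j := by
        rw [abs_mul, abs_mul, abs_two]
        gcongr
      _ ≤ (3 * R) ^ (j + 2) := by
        rw [pow_succ, pow_add]
        nlinarith [mul_le_mul hR hR zero_le_one (by linarith)]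

open Polynomial in
/-- Rescaled Chebyshev polynomials: monic polynomials of each degree `j` which are at most
`2 * ((b - a) / 4) ^ j` on `[a, b]`, and grow at most geometrically relative to this on `[-R, R]`. -/
theorem exists_monic_small_on_Icc {a b : ℝ} (hab : a < b) (R : ℝ) :
    ∃ C : ℝ, 1 ≤ C ∧ ∀ j : ℕ, ∃ p : ℝ[X], p.natDegree = j ∧ p.Monic ∧
      (∀ x, a ≤ x → x ≤ b → |p.eval x| ≤ 2 * ((b - a) / 4) ^ j) ∧
      (∀ x, |x| ≤ R → |p.eval x| ≤ 2 * ((b - a) / 4) ^ j * C ^ j) := by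
  have hd : 0 < b - a := sub_pos.2 hab
  set c := (b - a) / 4 with hc
  have hc0 : 0 < c := by positivity
  set R' : ℝ := 1 + (|R| + |(a + b) / 2|) / (2 * c) with hR'
  have hR1 : 1 ≤ R' := le_add_of_nonneg_right (by positivity)
  refine ⟨3 * R', by linarith, fun j ↦ ?_⟩
  obtain rfl | j := j
  · exact ⟨1, by simp, monic_one, by simp, by simp⟩
  set q : ℝ[X] := C (2 * c)⁻¹ * X + C (-((a + b) / 2) / (2 * c)) with hq
  have hc2 : (2 * c)⁻¹ ≠ 0 := by positivity
  have hqd : q.natDegree = 1 := natDegree_linear hc2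
  have hql : q.leadingCoeff = (2 * c)⁻¹ := leadingCoeff_linear hc2
  have hqe (x : ℝ) : q.eval x = (x - (a + b) / 2) / (2 * c) := by
    simp only [hq, eval_add, eval_mul, eval_C, eval_X]
    ring
  have hk : 2 * c ^ (j + 1) ≠ 0 := by positivity
  have he (x : ℝ) : |(C (2 * c ^ (j + 1)) * (Chebyshev.T ℝ (j + 1 : ℕ)).comp q).eval x| =
      2 * c ^ (j + 1) * |(Chebyshev.T ℝ (j + 1 : ℕ)).eval (q.eval x)| := by
    rw [eval_mul, eval_C, eval_comp, abs_mul, abs_of_pos (by positivity)]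
  refine ⟨C (2 * c ^ (j + 1)) * (Chebyshev.T ℝ (j + 1 : ℕ)).comp q, ?_, ?_, fun x h₁ h₂ ↦ ?_,
    fun x hx ↦ ?_⟩
  · rw [natDegree_C_mul hk, natDegree_comp, hqd, Chebyshev.natDegree_T, Int.natAbs_natCast,
      mul_one]
  · rw [Monic, leadingCoeff_mul, leadingCoeff_C, leadingCoeff_comp (by simp [hqd]), hql,
      Chebyshev.leadingCoeff_T, Chebyshev.natDegree_T, Int.natAbs_natCast, Nat.add_sub_cancel,
      inv_pow, mul_pow]
    field_simp
    ring
  · rw [he, hqe]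
    refine mul_le_of_le_one_right (by positivity) (Chebyshev.abs_eval_T_real_le_one _ ?_)
    rw [abs_div, abs_of_pos (by positivity : 0 < 2 * c), div_le_one (by positivity), abs_le]
    constructor <;> linarith
  · rw [he, hqe]
    gcongr
    refine abs_eval_chebyshevT_le hR1 ?_ _
    rw [abs_div, abs_of_pos (by positivity : 0 < 2 * c), hR']
    have : |x - (a + b) / 2| / (2 * c) ≤ (|R| + |(a + b) / 2|) / (2 * c) := by
      gcongr
      exact (abs_sub _ _).trans (by linarith [hx.trans (le_abs_self R)])
    linarith

/-- A Leibniz bound for determinants whose entries are bounded by a rank one matrix. -/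
theorem abs_det_le_factorial_mul {n : ℕ} (M : Matrix (Fin n) (Fin n) ℝ) (r k : Fin n → ℝ)
    (h : ∀ i j, |M i j| ≤ r i * k j) :
    |M.det| ≤ n.factorial * ((∏ i, r i) * ∏ j, k j) := by
  rw [Matrix.det_apply]
  refine (Finset.abs_sum_le_sum_abs _ _).trans ?_
  have : ∀ g ∈ (Finset.univ : Finset (Equiv.Perm (Fin n))),
      |Equiv.Perm.sign g • ∏ i, M (g i) i| ≤ (∏ i, r i) * ∏ j, k j := by
    intro g _
    rw [← Equiv.prod_comp g r, ← Finset.prod_mul_distrib]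
    obtain hs | hs := Int.units_eq_one_or (Equiv.Perm.sign g) <;>
    · simp only [hs, one_smul, Units.neg_smul, abs_neg, Finset.abs_prod]
      exact Finset.prod_le_prod (fun _ _ ↦ abs_nonneg _) fun i _ ↦ h _ _
  simpa [Fintype.card_perm] using Finset.sum_le_card_nsmul _ _ _ this

/-- Bound for the discriminant of `n` real points, all but `m` of which lie in `[a, b]`. -/
theorem exists_discriminant_bound {a b : ℝ} (hab : a < b) (R : ℝ) (m : ℕ) :
    ∃ C : ℝ, 1 ≤ C ∧ ∀ (n : ℕ) (v : Fin n → ℝ) (S : Finset (Fin n)), S.card ≤ m →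
      (∀ i ∈ S, |v i| ≤ R) → (∀ i ∉ S, a ≤ v i ∧ v i ≤ b) →
      ∏ i, ∏ j ∈ Finset.Ioi i, (v j - v i) ^ 2 ≤
        (n.factorial * C ^ n) ^ 2 * ((b - a) / 4) ^ (n * (n - 1)) := by
  obtain ⟨C, hC, hp⟩ := exists_monic_small_on_Icc hab R
  choose p hdeg hmonic hgood hbad using hp
  refine ⟨2 * C ^ m, by linarith [one_le_pow₀ hC (n := m)], fun n v S hS hvS hvS' ↦ ?_⟩
  have hd : 0 < b - a := sub_pos.2 hab
  have hc0 : 0 < (b - a) / 4 := by positivity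
  set c := (b - a) / 4
  have hdet := abs_det_le_factorial_mul (Matrix.of fun i j : Fin n ↦ (p j).eval (v i))
    (fun i ↦ if i ∈ S then C ^ n else 1) (fun j ↦ 2 * c ^ (j : ℕ)) fun i j ↦ by
      simp only [Matrix.of_apply]
      split_ifs with hi
      · refine (hbad j _ (hvS i hi)).trans ?_
        rw [mul_comm]
        gcongr
        exact j.2.le
      · rw [one_mul]
        exact hgood j _ (hvS' i hi).1 (hvS' i hi).2
  rw [← Matrix.det_eval_matrixOfPolynomials_eq_det_vandermonde v (fun j ↦ p j)
    (fun j ↦ hdeg j) (fun j ↦ hmonic j), Matrix.det_vandermonde] at hdet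
  have hprod : ∏ i, (if i ∈ S then C ^ n else 1) ≤ (C ^ m) ^ n := by
    rw [Finset.prod_ite_mem, Finset.univ_inter, Finset.prod_const, ← pow_mul, ← pow_mul, mul_comm n]
    exact pow_le_pow_right₀ hC (by gcongr)
  have hk : ∏ j : Fin n, 2 * c ^ (j : ℕ) = 2 ^ n * c ^ (∑ j ∈ Finset.range n, j) := by
    rw [Fin.prod_univ_eq_prod_range (fun j ↦ 2 * c ^ j), Finset.prod_mul_distrib,
      Finset.prod_pow_eq_pow_sum]
    simp
  simp only [Finset.prod_pow]
  rw [← sq_abs]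
  calc _ ≤ (n.factorial * ((C ^ m) ^ n * (2 ^ n * c ^ (∑ j ∈ Finset.range n, j)))) ^ 2 := by
        gcongr
        refine hdet.trans ?_
        rw [hk]
        gcongr
    _ = _ := by
        rw [← Finset.sum_range_id_mul_two]
        ring

/-- The product of the discriminant bounds is eventually less than `1`. -/
theorem exists_bound_of_one_le_prod {ι : Type*} [Fintype ι] (c C : ι → ℝ) (hc : ∀ i, 0 < c i)
    (hprod : ∏ i, c i < 1) (hC : ∀ i, 1 ≤ C i) :
    ∃ N : ℕ, ∀ n : ℕ, 1 ≤ ∏ i, (n.factorial * C i ^ n) ^ 2 * c i ^ (n * (n - 1)) → n ≤ N := by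
  set P := ∏ i, c i
  set K := ∏ i, C i
  set r := Fintype.card ι
  have hP : 0 < P := Finset.prod_pos fun i _ ↦ hc i
  have hK : 0 < K := Finset.prod_pos fun i _ ↦ by linarith [hC i]
  have hlim := (tendsto_pow_const_mul_const_pow_of_lt_one (2 * r) hP.le hprod).const_mul (K ^ 2 / P)
  rw [mul_zero] at hlim
  obtain ⟨N, hN⟩ := Filter.eventually_atTop.1 (hlim.eventually_lt_const zero_lt_one)
  refine ⟨N, fun n hn ↦ ?_⟩
  by_contra! hlt
  have hn0 : n ≠ 0 := by omega
  refine hn.not_gt ?_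
  calc _ = (n.factorial ^ (2 * r)) * (K ^ 2 * P ^ (n - 1)) ^ n := by
        rw [Finset.prod_mul_distrib, Finset.prod_pow, Finset.prod_pow, Finset.prod_mul_distrib,
          Finset.prod_pow]
        simp only [Finset.prod_const, Finset.card_univ]
        simp only [P, K, r]
        ring
    _ ≤ ((n : ℝ) ^ n) ^ (2 * r) * (K ^ 2 * P ^ (n - 1)) ^ n := by
        gcongr
        exact_mod_cast n.factorial_le_pow
    _ = (K ^ 2 / P * (n ^ (2 * r) * P ^ n)) ^ n := by
        obtain ⟨k, rfl⟩ := Nat.exists_eq_succ_of_ne_zero hn0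
        rw [← pow_mul, mul_comm (k + 1), pow_mul, ← mul_pow]
        congr 1
        simp only [Nat.succ_eq_add_one, Nat.add_sub_cancel, pow_succ P]
        field_simp
    _ < 1 := pow_lt_one₀ (by positivity) (hN n hlt.le) hn0


/-- The discriminant of a power basis at a complex embedding of the base. -/
theorem exists_embeddings_discr_eq {K L : Type*} [Field K] [Field L] [Algebra K L] [CharZero K]
    (pb : PowerBasis K L) (σ : K →+* ℂ) :
    ∃ e : Fin pb.dim → (L →+* ℂ), Function.Injective e ∧
      (∀ i, (e i).comp (algebraMap K L) = σ) ∧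
      σ (Algebra.discr K pb.basis) =
        ∏ i, ∏ j ∈ Finset.Ioi i, (e j pb.gen - e i pb.gen) ^ 2 := by
  let := σ.toAlgebra
  have := pb.finite
  have hcard : Fintype.card (Fin pb.dim) = Fintype.card (L →ₐ[K] ℂ) := by
    rw [AlgHom.card, Fintype.card_fin, pb.finrank]
  let e := Fintype.equivOfCardEq hcard
  refine ⟨fun i ↦ (e i : L →+* ℂ), fun i j hij ↦ e.injective (AlgHom.coe_ringHom_injective hij),
    fun i ↦ (e i).comp_algebraMap, ?_⟩
  exact Algebra.discr_powerBasis_eq_prod K ℂ pb e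

open NumberField.ComplexEmbedding in
/-- A complex embedding with values of vanishing imaginary part is real. -/
theorem isReal_of_im_eq_zero {K : Type*} [Field K] {φ : K →+* ℂ} (h : ∀ x, (φ x).im = 0) :
    IsReal φ :=
  RingHom.ext fun x ↦ Complex.conj_eq_iff_im.2 (h x)

/-- The discriminant of a power basis at a real embedding of the base, when the extension has only
real embeddings. -/
theorem exists_real_embeddings_discr_eq {K L : Type*} [Field K] [Field L] [Algebra K L]
    [CharZero K] (pb : PowerBasis K L) (hL : ∀ (ψ : L →+* ℂ) (x : L), (ψ x).im = 0)
    (σ : K →+* ℝ) :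
    ∃ e : Fin pb.dim → (L →+* ℝ), Function.Injective e ∧
      (∀ i, (e i).comp (algebraMap K L) = σ) ∧
      σ (Algebra.discr K pb.basis) =
        ∏ i, ∏ j ∈ Finset.Ioi i, (e j pb.gen - e i pb.gen) ^ 2 := by
  obtain ⟨e, hinj, hcomp, hdiscr⟩ := exists_embeddings_discr_eq pb (Complex.ofRealHom.comp σ)
  have hreal i := isReal_of_im_eq_zero (hL (e i))
  have hcoe (i : Fin pb.dim) (x : L) : ((hreal i).embedding x : ℂ) = e i x :=
    (hreal i).coe_embedding_apply x
  refine ⟨fun i ↦ (hreal i).embedding, fun i j hij ↦ hinj ?_, fun i ↦ ?_, ?_⟩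
  · ext x
    rw [← hcoe, ← hcoe]
    exact congrArg _ (RingHom.congr_fun hij x)
  · ext x
    apply Complex.ofReal_injective
    simpa [hcoe] using RingHom.congr_fun (hcomp i) x
  · apply Complex.ofReal_injective
    push_cast
    simpa only [hcoe, RingHom.comp_apply, Complex.ofRealHom_eq_coe] using hdiscr

/-- A nonzero algebraic integer of a totally real number field has norm at least one. -/
theorem one_le_prod_abs_real_embeddings {K : Type*} [Field K] [NumberField K]
    (hK : ∀ (φ : K →+* ℂ) (x : K), (φ x).im = 0) {d : K} (hd : IsIntegral ℤ d) (hd0 : d ≠ 0) :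
    1 ≤ ∏ σ : K →+* ℝ, |σ d| := by
  have hbij : Function.Bijective
      fun σ : K →+* ℝ ↦ (Complex.ofRealHom.comp σ).toRatAlgHom := by
    refine ⟨fun σ σ' h ↦ ?_, fun φ ↦ ?_⟩
    · ext x
      exact Complex.ofReal_injective (AlgHom.congr_fun h x)
    · have hφ := isReal_of_im_eq_zero (hK (φ : K →+* ℂ))
      refine ⟨hφ.embedding, ?_⟩
      ext x
      exact hφ.coe_embedding_apply x
  have hnorm : ((Algebra.norm ℚ d : ℚ) : ℝ) = ∏ σ : K →+* ℝ, σ d := by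
    apply Complex.ofReal_injective
    have h := Algebra.norm_eq_prod_embeddings ℚ ℂ d
    rw [← hbij.prod_comp] at h
    push_cast
    simpa using h
  obtain ⟨z, hz⟩ := IsIntegrallyClosed.isIntegral_iff.1 (Algebra.isIntegral_norm ℚ hd)
  have hz0 : z ≠ 0 := by
    rintro rfl
    exact hd0 (Algebra.norm_eq_zero_iff (R := ℚ).1 (by rw [← hz, map_zero]))
  rw [← Finset.abs_prod, ← hnorm, ← hz]
  simpa using (by exact_mod_cast Int.one_le_abs hz0 : (1 : ℝ) ≤ |(z : ℝ)|)

/-- The relative degree bound, for an extension given by a power basis. -/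
theorem exists_powerBasis_dim_bound {K : Type*} [Field K] [NumberField K]
    (hK : ∀ (φ : K →+* ℂ) (x : K), (φ x).im = 0) (a b : (K →+* ℝ) → ℝ)
    (hab : ∏ σ : K →+* ℝ, (b σ - a σ) / 4 < 1) (m : ℕ) (s t : Fin m → ℝ) :
    ∃ N : ℕ, ∀ {L : Type*} [Field L] [Algebra K L] (pb : PowerBasis K L), IsIntegral ℤ pb.gen →
      (∀ (ψ : L →+* ℂ) (x : L), (ψ x).im = 0) →
      ∀ τ : Fin m → (L →+* ℝ), (∀ i, s i ≤ τ i pb.gen ∧ τ i pb.gen ≤ t i) →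
      (∀ τ' : L →+* ℝ, τ' ∉ Set.range τ →
        a (τ'.comp (algebraMap K L)) ≤ τ' pb.gen ∧ τ' pb.gen ≤ b (τ'.comp (algebraMap K L))) →
      pb.dim ≤ N := by
  classical
  have hcard {L : Type _} [Field L] (n : ℕ) (τ : Fin m → (L →+* ℝ)) (e : Fin n → (L →+* ℝ))
      (he : Function.Injective e) :
      (Finset.univ.filter fun i ↦ e i ∈ Set.range τ).card ≤ m := by
    rw [← Finset.card_image_of_injective _ he]
    calc _ ≤ (Finset.univ.image τ).card := Finset.card_le_card fun x hx ↦ by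
            simp only [Finset.mem_image, Finset.mem_filter, Finset.mem_univ, true_and] at hx ⊢
            obtain ⟨i, ⟨k, hk⟩, rfl⟩ := hx
            exact ⟨k, hk⟩
      _ ≤ m := Finset.card_image_le.trans (by simp)
  by_cases hlt : ∀ σ, a σ < b σ
  · set R := ∑ i, (|s i| + |t i|)
    choose C hC hdisc using fun σ ↦ exists_discriminant_bound (hlt σ) R m
    obtain ⟨N, hN⟩ := exists_bound_of_one_le_prod (fun σ ↦ (b σ - a σ) / 4) C
      (fun σ ↦ by linarith [hlt σ]) hab hC
    refine ⟨N, fun {L} _ _ pb hint hL τ hτ hτ' ↦ hN _ ?_⟩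
    have := pb.finite
    refine (one_le_prod_abs_real_embeddings hK (d := Algebra.discr K pb.basis) ?_
      (Algebra.discr_not_zero_of_basis K pb.basis)).trans ?_
    · refine Algebra.discr_isIntegral (R := ℤ) K fun i ↦ ?_
      rw [pb.basis_eq_pow]
      exact hint.pow _
    refine Finset.prod_le_prod (fun _ _ ↦ abs_nonneg _) fun σ _ ↦ ?_
    obtain ⟨e, he, hcomp, hd⟩ := exists_real_embeddings_discr_eq pb hL σ
    rw [hd, abs_of_nonneg (Finset.prod_nonneg fun _ _ ↦ Finset.prod_nonneg fun _ _ ↦ sq_nonneg _)]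
    refine hdisc σ _ (fun i ↦ e i pb.gen) _ (hcard _ τ e he) (fun i hi ↦ ?_) fun i hi ↦ ?_
    · obtain ⟨k, hk⟩ := (Finset.mem_filter.1 hi).2
      rw [← hk]
      calc |τ k pb.gen| ≤ |s k| + |t k| := by
            rw [abs_le]
            constructor <;> linarith [hτ k, neg_abs_le (s k), le_abs_self (t k), abs_nonneg (s k),
              abs_nonneg (t k)]
        _ ≤ R := Finset.single_le_sum (f := fun i ↦ |s i| + |t i|) (fun _ _ ↦ by positivity)
            (Finset.mem_univ k)
    · simpa only [hcomp] using hτ' (e i) (by simpa using hi)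
  · push Not at hlt
    obtain ⟨σ, hσ⟩ := hlt
    refine ⟨m + 1, fun {L} _ _ pb _ hL τ _ hτ' ↦ ?_⟩
    obtain ⟨e, he, hcomp, _⟩ := exists_real_embeddings_discr_eq pb hL σ
    have hbad := hcard _ τ e he
    have hgood : (Finset.univ.filter fun i ↦ e i ∉ Set.range τ).card ≤ 1 := by
      refine Finset.card_le_one.2 fun i hi j hj ↦ ?_
      have h₁ := hτ' (e i) (Finset.mem_filter.1 hi).2
      have h₂ := hτ' (e j) (Finset.mem_filter.1 hj).2
      rw [hcomp] at h₁ h₂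
      have hgen : e i pb.gen = e j pb.gen := by linarith
      let := σ.toAlgebra
      let f (k : Fin pb.dim) : L →ₐ[K] ℝ := { e k with commutes' := RingHom.congr_fun (hcomp k) }
      have hf : f i = f j := pb.algHom_ext hgen
      exact he (congrArg (fun g : L →ₐ[K] ℝ ↦ (g : L →+* ℝ)) hf)
    have hsum := Finset.card_filter_add_card_filter_not (s := (Finset.univ : Finset (Fin pb.dim)))
      fun i ↦ e i ∈ Set.range τ
    rw [Finset.card_univ, Fintype.card_fin] at hsum
    omega

/-- Adjoining a totally real number to a totally real field yields a totally real field. -/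
theorem im_eq_zero_of_adjoin_simple {F : IntermediateField ℚ ℝ}
    (hF : ∀ (σ : F →+* ℂ) (x : F), (σ x).im = 0) {α : ℝ}
    (hα : ∀ z : ℂ, Polynomial.aeval z (minpoly ℚ α) = 0 → z.im = 0)
    (ψ : IntermediateField.adjoin F {α} →+* ℂ) (x : IntermediateField.adjoin F {α}) :
    (ψ x).im = 0 := by
  obtain ⟨x, hx⟩ := x
  induction hx using IntermediateField.adjoin_induction with
  | mem x hx =>
    obtain rfl : x = α := hx
    refine hα _ ?_
    have h : Polynomial.aeval (⟨x, IntermediateField.mem_adjoin_simple_self F x⟩ :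
        IntermediateField.adjoin F {x}) (minpoly ℚ x) = 0 := by
      apply Subtype.val_injective
      have := Polynomial.aeval_algHom_apply
        ((IntermediateField.adjoin F {x}).val.restrictScalars ℚ)
        ⟨x, IntermediateField.mem_adjoin_simple_self F x⟩ (minpoly ℚ x)
      exact this.symm.trans (minpoly.aeval ℚ x)
    have h' := Polynomial.aeval_algHom_apply ψ.toRatAlgHom
      ⟨x, IntermediateField.mem_adjoin_simple_self F x⟩ (minpoly ℚ x)
    rw [h, map_zero] at h'
    exact h'
  | algebraMap x => exact hF (ψ.comp (algebraMap F (IntermediateField.adjoin F {α}))) x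
  | add x y hx hy ihx ihy =>
    rw [show (⟨x + y, add_mem hx hy⟩ : IntermediateField.adjoin F {α}) = ⟨x, hx⟩ + ⟨y, hy⟩ from rfl,
      map_add, Complex.add_im, ihx, ihy, add_zero]
  | inv x hx ih =>
    rw [show (⟨x⁻¹, inv_mem hx⟩ : IntermediateField.adjoin F {α}) = ⟨x, hx⟩⁻¹ from rfl,
      map_inv₀, Complex.inv_im, ih, neg_zero, zero_div]
  | mul x y hx hy ihx ihy =>
    rw [show (⟨x * y, mul_mem hx hy⟩ : IntermediateField.adjoin F {α}) = ⟨x, hx⟩ * ⟨y, hy⟩ from rfl,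
      map_mul, Complex.mul_im, ihx, ihy, mul_zero, zero_mul, add_zero]

/-- **Nikulin, Theorem 1.2.1.** Let `F` be a totally real number field (here realized as a
subfield of `ℝ`), with an interval `[a σ, b σ]` assigned to each real embedding
`σ : F → ℝ` such that `∏ σ, (b σ - a σ)/4 < 1`.  Fix `m` intervals `[s i, t i]`.
Then there is a constant `N` such that for every totally real algebraic integer `α`,
if there are `m` pairwise distinct real embeddings `τ i : F(α) → ℝ` with
`s i ≤ τ i α ≤ t i`, while every other real embedding `τ'` of `F(α)` satisfies
`a (τ'|F) ≤ τ' α ≤ b (τ'|F)`, then `[F(α) : F] ≤ N`. -/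
theorem nikulin_th121
    (F : IntermediateField ℚ ℝ) [NumberField ↥F]
    (hFtotreal : ∀ σ : F →+* ℂ, ∀ x : F, (σ x).im = 0)
    (a b : (F →+* ℝ) → ℝ)
    (hab : ∏ σ : F →+* ℝ, (b σ - a σ) / 4 < 1)
    (m : ℕ) (s t : Fin m → ℝ) :
    ∃ N : ℕ, ∀ α : ℝ, IsIntegral ℤ α →
      (∀ z : ℂ, Polynomial.aeval z (minpoly ℚ α) = 0 → z.im = 0) →
      ∀ τ : Fin m → (IntermediateField.adjoin F {α} →+* ℝ),
        Function.Injective τ →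
        (∀ i : Fin m,
          s i ≤ τ i ⟨α, IntermediateField.mem_adjoin_simple_self F α⟩ ∧
          τ i ⟨α, IntermediateField.mem_adjoin_simple_self F α⟩ ≤ t i) →
        (∀ τ' : IntermediateField.adjoin F {α} →+* ℝ, τ' ∉ Set.range τ →
          a (τ'.comp (algebraMap F (IntermediateField.adjoin F {α}))) ≤
            τ' ⟨α, IntermediateField.mem_adjoin_simple_self F α⟩ ∧
          τ' ⟨α, IntermediateField.mem_adjoin_simple_self F α⟩ ≤
            b (τ'.comp (algebraMap F (IntermediateField.adjoin F {α})))) →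
        Module.finrank F (IntermediateField.adjoin F {α}) ≤ N := by
  obtain ⟨N, hN⟩ := exists_powerBasis_dim_bound hFtotreal a b hab m s t
  refine ⟨N, fun α hint hα τ _ hτ hτ' ↦ ?_⟩
  have hF : IsIntegral F α := hint.tower_top
  let pb := IntermediateField.adjoin.powerBasis hF
  have hgen : pb.gen = ⟨α, IntermediateField.mem_adjoin_simple_self F α⟩ :=
    IntermediateField.adjoin.powerBasis_gen hF
  have hreal := im_eq_zero_of_adjoin_simple hFtotreal hα
  rw [pb.finrank]
  refine hN pb ?_ hreal τ (by simpa only [hgen] using hτ) (by simpa only [hgen] using hτ')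
  rw [hgen]
  exact (isIntegral_algHom_iff ((IntermediateField.adjoin F {α}).val.restrictScalars ℤ)
    Subtype.val_injective).1 hint
end

section
/- Let l ≥ 3 be an integer and let K be a totally real number field with F_l ⊆ K and K = ℚ(α), where α ≠ 0 is an algebraic integer. Let a_1, a_2 ≥ 0 with a := max{a_1, a_2} satisfying 0 < a < 4, let b_1 < b_2 be real numbers with b := max{|b_1|, |b_2|} ≥ a. Assume that for every real embedding σ : K → ℝ other than the identity one has −a_1·σ(sin²(π/l)) < σ(α) < a_2·σ(sin²(π/l)), while b_1 < α < b_2. Then N := [K : ℚ] satisfies N·(ln(2/√a) − ln γ(l)/φ(l)) < ln √(b/a) − ln sin(π/l), and moreover φ(l)/2 divides N. -/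
open scoped Classical in
/-- `γ(l) = p` if `l = p^t` is a prime power (`t ≥ 1`), and `γ(l) = 1` otherwise;
one has `N_{F_l/ℚ}(4 sin²(π/l)) = γ(l)`. -/
noncomputable def gam (l : ℕ) : ℕ := if IsPrimePow l then l.minFac else 1

open Polynomial IntermediateField

theorem eval_one_cyclotomic_eq_gam {l : ℕ} (hl : 2 ≤ l) :
    eval 1 (cyclotomic l ℤ) = (gam l : ℤ) := by
  unfold gam
  split_ifs with h
  · obtain ⟨p, k, hp', hk, rfl⟩ := (isPrimePow_nat_iff l).1 h
    obtain ⟨k, rfl⟩ := Nat.exists_eq_succ_of_ne_zero hk.ne'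
    have : Fact p.Prime := ⟨hp'⟩
    rw [Nat.succ_eq_add_one, eval_one_cyclotomic_prime_pow, hp'.pow_minFac (by omega)]
  · rw [eval_one_cyclotomic_not_prime_pow]
    · simp
    · rintro p hp k rfl
      refine h (hp.isPrimePow.pow ?_)
      rintro rfl
      simp at hl

theorem gam_pos (l : ℕ) : 0 < gam l := by
  unfold gam
  split_ifs
  · exact l.minFac_pos
  · exact one_pos

/-- In a finite extension of `k` containing a primitive `l`-th root of unity `ζ`, the norm of `ζ - 1`
is a power of `γ(l)`, provided that the `l`-th cyclotomic polynomial is irreducible over `k`. -/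
theorem norm_primitiveRoot_sub_one_eq_gam_pow {k L : Type*} [Field k] [Field L] [Algebra k L]
    [FiniteDimensional k L] {l : ℕ} (hl : 3 ≤ l) (hirr : Irreducible (cyclotomic l k)) {ζ : L}
    (hζ : IsPrimitiveRoot ζ l) :
    ∃ d : ℕ, Module.finrank k L = l.totient * d ∧
      Algebra.norm k (ζ - 1) = (gam l : k) ^ d := by
  have : NeZero l := ⟨by omega⟩
  have := hζ.intermediateField_adjoin_isCyclotomicExtension k
  have hζ' : IsPrimitiveRoot (AdjoinSimple.gen k ζ) l :=
    IsPrimitiveRoot.coe_submonoidClass_iff.mp hζ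
  refine ⟨Module.finrank k⟮ζ⟯ L, ?_, ?_⟩
  · rw [← IsCyclotomicExtension.finrank k⟮ζ⟯ hirr, Module.finrank_mul_finrank]
  · rw [show ζ - 1 = algebraMap k⟮ζ⟯ L (AdjoinSimple.gen k ζ - 1) by rfl,
      ← Algebra.norm_norm (S := k⟮ζ⟯), Algebra.norm_algebraMap, map_pow,
      hζ'.sub_one_norm_eq_eval_cyclotomic (by omega) hirr,
      eval_one_cyclotomic_eq_gam (by omega)]
    simp

/-- A non-real complex root of a monic quadratic polynomial over a real field generates a quadratic
extension of that field. -/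
theorem finrank_adjoin_eq_two_of_im_ne_zero (K : IntermediateField ℚ ℝ) {z : ℂ} (hz : z.im ≠ 0)
    (t : K) (h : z ^ 2 - algebraMap K ℂ t * z + 1 = 0) :
    IsIntegral K z ∧ Module.finrank K K⟮z⟯ = 2 := by
  have hdeg : (X ^ 2 - C t * X + 1 : K[X]).natDegree = 2 := by compute_degree!
  have hmonic : (X ^ 2 - C t * X + 1 : K[X]).Monic := by monicity!
  have hroot : aeval z (X ^ 2 - C t * X + 1 : K[X]) = 0 := by simpa using h
  have hint : IsIntegral K z := ⟨_, hmonic, by simpa [aeval_def] using hroot⟩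
  refine ⟨hint, ?_⟩
  rw [adjoin.finrank hint]
  refine le_antisymm ?_ ?_
  · rw [← hdeg]
    exact natDegree_le_of_dvd (minpoly.dvd K z hroot) hmonic.ne_zero
  · refine (minpoly.two_le_natDegree_iff hint).2 ?_
    rintro ⟨x, rfl⟩
    exact hz (Complex.ofReal_im (x : ℝ))

/-- If `ζ` is a primitive `l`-th root of unity in a quadratic extension `L` of a number field `K`,
and `(ζ - 1) (ζ⁻¹ - 1)` lies in `K`, then its norm from `K` is determined by `γ(l)`. -/
theorem norm_sq_eq_gam_pow_of_quadratic {K L : Type*} [Field K] [Field L] [Algebra ℚ K]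
    [Algebra ℚ L] [Algebra K L] [FiniteDimensional ℚ K] [FiniteDimensional K L] {l : ℕ}
    (hl : 3 ≤ l) (hfin : Module.finrank K L = 2) {ζ : L} (hζ : IsPrimitiveRoot ζ l) {u : K}
    (hu : algebraMap K L u = (ζ - 1) * (ζ⁻¹ - 1)) :
    ∃ d : ℕ, 2 * Module.finrank ℚ K = l.totient * d ∧
      Algebra.norm ℚ u ^ 2 = (gam l : ℚ) ^ (2 * d) := by
  have : FiniteDimensional ℚ L := FiniteDimensional.trans ℚ K L
  have hirr := cyclotomic.irreducible_rat (n := l) (by omega)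
  obtain ⟨d, hd, hnd⟩ := norm_primitiveRoot_sub_one_eq_gam_pow hl hirr hζ
  obtain ⟨d', hd', hnd'⟩ := norm_primitiveRoot_sub_one_eq_gam_pow hl hirr hζ.inv
  have hφ : 0 < l.totient := Nat.totient_pos.2 (by omega)
  obtain rfl : d = d' := Nat.eq_of_mul_eq_mul_left hφ (hd.symm.trans hd')
  refine ⟨d, ?_, ?_⟩
  · rw [← hd, ← Module.finrank_mul_finrank ℚ K L, hfin, mul_comm]
  · have := Algebra.norm_norm (R := ℚ) (S := K) (a := algebraMap K L u)
    rw [Algebra.norm_algebraMap, hfin, map_pow, hu, map_mul, hnd, hnd'] at this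
    rw [this]
    ring

/-- The norm of `4 sin²(π/l)` from a real number field. -/
theorem norm_four_mul_sin_sq (l : ℕ) (hl : 3 ≤ l) (K : IntermediateField ℚ ℝ)
    [FiniteDimensional ℚ K] (s : K) (hs : (s : ℝ) = Real.sin (Real.pi / l) ^ 2) :
    ∃ d : ℕ, 2 * Module.finrank ℚ K = l.totient * d ∧
      Algebra.norm ℚ (4 * s) ^ 2 = (gam l : ℚ) ^ (2 * d) := by
  have hl0 : (0 : ℝ) < l := by positivity
  set z : ℂ := Complex.exp (2 * Real.pi * Complex.I / l) with hzdef
  have hz : IsPrimitiveRoot z l := Complex.isPrimitiveRoot_exp l (by omega)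
  have hzexp : z = Complex.exp ((2 * (Real.pi / l) : ℝ) * Complex.I) := by
    rw [hzdef]; congr 1; push_cast; ring
  have hre : z.re = 1 - 2 * (s : ℝ) := by
    rw [hzexp, Complex.exp_ofReal_mul_I_re, Real.cos_two_mul, hs, Real.sin_sq]; ring
  have him : z.im ≠ 0 := by
    rw [hzexp, Complex.exp_ofReal_mul_I_im]
    refine (Real.sin_pos_of_pos_of_lt_pi (by positivity) ?_).ne'
    rw [mul_div_assoc', div_lt_iff₀ hl0]
    have : (3 : ℝ) ≤ l := by exact_mod_cast hl
    nlinarith [Real.pi_pos]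
  have hnorm : z.re ^ 2 + z.im ^ 2 = 1 := by
    rw [hzexp, Complex.exp_ofReal_mul_I_im, Complex.exp_ofReal_mul_I_re]
    exact Real.cos_sq_add_sin_sq _
  have hquad : z ^ 2 - algebraMap K ℂ (2 - 4 * s) * z + 1 = 0 := by
    have e : algebraMap K ℂ (2 - 4 * s) = ((2 * z.re : ℝ) : ℂ) := by
      rw [hre]
      change ((2 - 4 * (s : ℝ) : ℝ) : ℂ) = _
      push_cast
      ring
    rw [e]
    apply Complex.ext
    · simp [pow_two]; nlinarith
    · simp [pow_two]; ring
  obtain ⟨hint, hfin⟩ := finrank_adjoin_eq_two_of_im_ne_zero K him _ hquad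
  have : FiniteDimensional K K⟮z⟯ := adjoin.finiteDimensional hint
  have hζ : IsPrimitiveRoot (AdjoinSimple.gen K z) l :=
    IsPrimitiveRoot.coe_submonoidClass_iff.mp hz
  refine norm_sq_eq_gam_pow_of_quadratic hl hfin hζ ?_
  apply (algebraMap K⟮z⟯ ℂ).injective
  have hz0 : z ≠ 0 := hz.ne_zero (by omega)
  rw [map_sub, map_ofNat] at hquad
  rw [← IsScalarTower.algebraMap_apply, map_mul (algebraMap K⟮z⟯ ℂ), map_sub, map_sub, map_inv₀, map_one,
    AdjoinSimple.algebraMap_gen]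
  field_simp
  linear_combination hquad

/-- If, away from the identity embedding, all conjugates of `x` are bounded by `a` times those of
`y`, the norms compare up to the contribution of the identity embedding. -/
theorem abs_norm_mul_le_of_conjugates_le (K : IntermediateField ℚ ℝ) [FiniteDimensional ℚ K]
    (hK : ∀ σ : K →+* ℂ, ∀ x : K, (σ x).im = 0) (x y : K) {a : ℝ} (ha : 0 ≤ a)
    (h : ∀ σ : K →+* ℝ, σ ≠ algebraMap K ℝ → |σ x| ≤ a * |σ y|) :
    |(Algebra.norm ℚ x : ℝ)| * (a * |(y : ℝ)|) ≤
      |(x : ℝ)| * (a ^ Module.finrank ℚ K * |(Algebra.norm ℚ y : ℝ)|) := by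
  classical
  have hn (w : K) : |(Algebra.norm ℚ w : ℝ)| = ∏ σ : K →ₐ[ℚ] ℂ, ‖σ w‖ := by
    rw [← norm_prod, ← Algebra.norm_eq_prod_embeddings ℚ ℂ w, eq_ratCast,
      ← Complex.ofReal_ratCast, Complex.norm_real, Real.norm_eq_abs]
  let ι : K →ₐ[ℚ] ℂ := (Complex.ofRealHom.comp (algebraMap K ℝ)).toRatAlgHom
  have hι (w : K) : ‖ι w‖ = |(w : ℝ)| := (Complex.norm_real _).trans (Real.norm_eq_abs _)
  have hle (σ : K →ₐ[ℚ] ℂ) (hσ : σ ≠ ι) : ‖σ x‖ ≤ a * ‖σ y‖ := by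
    have hre (w : K) : σ w = ((σ w).re : ℂ) :=
      Complex.ext rfl (hK (σ : K →+* ℂ) w)
    let τ : K →+* ℝ :=
      { toFun := fun w ↦ (σ w).re
        map_one' := by simp
        map_zero' := by simp
        map_add' := fun u v ↦ by simp
        map_mul' := fun u v ↦ by
          have hu : (σ u).im = 0 := hK (σ : K →+* ℂ) u
          simp [hu] }
    have hτ (w : K) : ‖σ w‖ = |τ w| := by
      rw [hre w, Complex.norm_real, Real.norm_eq_abs]; rfl
    rw [hτ, hτ]
    refine h τ fun e ↦ hσ (AlgHom.ext fun w ↦ ?_)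
    rw [hre w]
    exact congrArg Complex.ofReal (RingHom.congr_fun e w)
  rw [hn, hn, ← AlgHom.card ℚ K ℂ, ← Finset.card_univ, ← Finset.prod_const,
    ← Finset.prod_mul_distrib, ← Finset.mul_prod_erase _ _ (Finset.mem_univ ι),
    ← Finset.mul_prod_erase _ (fun σ : K →ₐ[ℚ] ℂ ↦ a * ‖σ y‖) (Finset.mem_univ ι), hι, hι,
    mul_assoc, mul_comm (∏ σ ∈ _, _)]
  have := Finset.prod_le_prod (s := Finset.univ.erase ι) (f := fun σ ↦ ‖σ x‖)
    (g := fun σ ↦ a * ‖σ y‖) (fun _ _ ↦ norm_nonneg _)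
    (fun σ hσ ↦ hle σ (Finset.ne_of_mem_erase hσ))
  gcongr

theorem one_le_abs_norm_of_isIntegral (K : IntermediateField ℚ ℝ) [FiniteDimensional ℚ K]
    {x : K} (hx0 : x ≠ 0) (hx : IsIntegral ℤ (x : ℝ)) :
    1 ≤ |(Algebra.norm ℚ x : ℝ)| := by
  have hx' : IsIntegral ℤ x :=
    (isIntegral_algebraMap_iff (algebraMap K ℝ).injective).1 hx
  obtain ⟨n, hn⟩ := IsIntegrallyClosed.isIntegral_iff.1 (Algebra.isIntegral_norm ℚ hx')
  have hn0 : n ≠ 0 := by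
    rintro rfl
    exact (Algebra.norm_ne_zero_iff (R := ℚ)).2 hx0 (by rw [← hn, map_zero])
  rw [← hn]
  have : (1 : ℝ) ≤ |(n : ℝ)| := by exact_mod_cast Int.one_le_abs hn0
  simpa using this

/-- **Case 1 norm estimate (Method B).** Let `l ≥ 3`, and let `K = ℚ(α)` be a totally
real number field (realized inside `ℝ`) containing `F_l = ℚ(cos(2π/l))`, where `α ≠ 0`
is an algebraic integer with `-a₁ σ(sin²(π/l)) < σ(α) < a₂ σ(sin²(π/l))` for every
real embedding `σ ≠ id` and `b₁ < α < b₂`, where `a₁, a₂ ≥ 0`,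
`0 < a = max{a₁,a₂} < 4`, `b₁ < b₂`, `b = max{|b₁|,|b₂|} ≥ a`.  Then `N = [K : ℚ]`
satisfies `N (ln(2/√a) - ln γ(l)/φ(l)) < ln √(b/a) - ln sin(π/l)` and `φ(l)/2 ∣ N`. -/
theorem nikulin_case1_estimate
    (l : ℕ) (hl : 3 ≤ l)
    (K : IntermediateField ℚ ℝ) [FiniteDimensional ℚ K]
    (hKtotreal : ∀ σ : K →+* ℂ, ∀ x : K, (σ x).im = 0)
    (hcos : Real.cos (2 * Real.pi / l) ∈ K)
    (α : K) (hα0 : α ≠ 0) (hαint : IsIntegral ℤ (α : ℝ))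
    (hKα : K = IntermediateField.adjoin ℚ {(α : ℝ)})
    (sl : K) (hsl : (sl : ℝ) = Real.sin (Real.pi / l) ^ 2)
    (a₁ a₂ b₁ b₂ : ℝ) (ha₁ : 0 ≤ a₁) (ha₂ : 0 ≤ a₂)
    (ha : 0 < max a₁ a₂) (ha4 : max a₁ a₂ < 4)
    (hb : b₁ < b₂) (hab : max a₁ a₂ ≤ max |b₁| |b₂|)
    (hσ : ∀ σ : K →+* ℝ, σ ≠ algebraMap K ℝ →
      -a₁ * σ sl < σ α ∧ σ α < a₂ * σ sl)
    (hgeo : b₁ < (α : ℝ) ∧ (α : ℝ) < b₂) :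
    (Module.finrank ℚ K : ℝ) *
        (Real.log (2 / Real.sqrt (max a₁ a₂)) -
          Real.log (gam l) / (Nat.totient l : ℝ)) <
      Real.log (Real.sqrt (max |b₁| |b₂| / max a₁ a₂)) -
        Real.log (Real.sin (Real.pi / l)) ∧
    Nat.totient l / 2 ∣ Module.finrank ℚ K := by
  obtain ⟨d, hd, hnd⟩ := norm_four_mul_sin_sq l hl K sl hsl
  have hφ : 0 < l.totient := Nat.totient_pos.2 (by omega)
  refine ⟨?_, ?_⟩
  swap
  · obtain ⟨m, hm⟩ := (Nat.totient_even hl).two_dvd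
    rw [hm] at hd ⊢
    exact ⟨d, by rw [Nat.mul_div_cancel_left _ two_pos]; nlinarith⟩
  set a := max a₁ a₂
  set b := max |b₁| |b₂|
  set N := Module.finrank ℚ K
  have hsin : 0 < Real.sin (Real.pi / l) := by
    refine Real.sin_pos_of_pos_of_lt_pi (by positivity) (div_lt_self Real.pi_pos ?_)
    exact_mod_cast (by omega : 1 < l)
  have hsl0 : (0 : ℝ) < sl := by rw [hsl]; positivity
  have hb0 : 0 < b := ha.trans_le hab
  have hαb : |(α : ℝ)| < b := by
    refine abs_lt.2 ⟨?_, ?_⟩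
    · linarith [neg_abs_le b₁, le_max_left |b₁| |b₂|, hgeo.1]
    · linarith [le_abs_self b₂, le_max_right |b₁| |b₂|, hgeo.2]
  have hconj (σ : K →+* ℝ) (hne : σ ≠ algebraMap K ℝ) : |σ α| ≤ a * |σ sl| := by
    obtain ⟨h1, h2⟩ := hσ σ hne
    have hpos : 0 < σ sl := by
      by_contra! hneg
      nlinarith [mul_nonneg (add_nonneg ha₁ ha₂) (neg_nonneg.2 hneg)]
    rw [abs_of_pos hpos]
    refine abs_le.2 ⟨?_, ?_⟩
    · nlinarith [mul_le_mul_of_nonneg_right (le_max_left a₁ a₂) hpos.le]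
    · nlinarith [mul_le_mul_of_nonneg_right (le_max_right a₁ a₂) hpos.le]
  have hmain := abs_norm_mul_le_of_conjugates_le K hKtotreal α sl ha.le hconj
  have hone := one_le_abs_norm_of_isIntegral K hα0 hαint
  set n : ℝ := |(Algebra.norm ℚ sl : ℝ)| with hn_def
  have hn4 : 4 ^ N * n = (gam l : ℝ) ^ d := by
    have h4 : Algebra.norm ℚ (4 * sl) = 4 ^ N * Algebra.norm ℚ sl := by
      rw [map_mul, ← Algebra.norm_algebraMap (S := K) (4 : ℚ),
        map_ofNat (algebraMap ℚ K)]
    have hsq : (4 ^ N * n) ^ 2 = ((gam l : ℝ) ^ d) ^ 2 := by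
      rw [hn_def, mul_pow, sq_abs, ← mul_pow, ← pow_mul, mul_comm d]
      rw [h4] at hnd
      exact_mod_cast hnd
    exact (pow_left_inj₀ (by positivity) (by positivity) two_ne_zero).1 hsq
  have hγ : (0 : ℝ) < gam l := by exact_mod_cast gam_pos l
  have hn0 : 0 < n := pos_of_mul_pos_right (hn4 ▸ pow_pos hγ d) (by positivity)
  have hlt : a * (sl : ℝ) < b * (a ^ N * n) := by
    rw [abs_of_pos hsl0] at hmain
    calc a * (sl : ℝ) ≤ _ := le_mul_of_one_le_left (by positivity) hone
      _ ≤ _ := hmain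
      _ < _ := by gcongr
  have hlog := Real.log_lt_log (by positivity) hlt
  have hlogn := congrArg Real.log hn4
  rw [hsl, Real.log_mul ha.ne' (by positivity), Real.log_mul hb0.ne' (by positivity),
    Real.log_mul (by positivity) hn0.ne', Real.log_pow, Real.log_pow] at hlog
  rw [Real.log_mul (by positivity) hn0.ne', Real.log_pow, Real.log_pow,
    show (4 : ℝ) = 2 ^ 2 by norm_num, Real.log_pow] at hlogn
  rw [Real.log_div two_ne_zero (by positivity), Real.log_sqrt ha.le, Real.log_sqrt (by positivity),
    Real.log_div hb0.ne' ha.ne']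
  have hd' : (N : ℝ) * (Real.log (gam l) / l.totient) = d * Real.log (gam l) / 2 := by
    have hcast : 2 * (N : ℝ) = l.totient * d := by exact_mod_cast hd
    field_simp
    linear_combination Real.log (gam l) * hcast
  rw [mul_sub, hd']
  push_cast at hlog hlogn
  linarith
end

section
/- For every integer l ≥ 6, Euler's totient function satisfies φ(l)·ln(ln l) ≥ C·l, where C = φ(6)·ln(ln 6)/6 = ln(ln 6)/3 (so that equality holds at l = 6). -/
open Real Finset

section PrimeSums

/-- A crude form of Stirling's upper bound. -/
lemma log_factorial_le {n : ℕ} (hn : 1 ≤ n) :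
    log (n.factorial : ℝ) ≤ n * log n - n + log n + 1 := by
  induction n, hn using Nat.le_induction with
  | base => simp
  | succ n hn ih =>
    have hn0 : (0 : ℝ) < n := by exact_mod_cast hn
    have hstep : 1 ≤ ((n : ℝ) + 1) * (log (n + 1) - log n) := by
      rw [← log_div (by positivity) hn0.ne']
      have h := one_sub_inv_le_log_of_pos (x := ((n : ℝ) + 1) / n) (by positivity)
      calc (1 : ℝ) = (n + 1) * (1 - (((n : ℝ) + 1) / n)⁻¹) := by field_simp; ring
        _ ≤ _ := by gcongr
    rw [Nat.factorial_succ, Nat.cast_mul, log_mul (by positivity) (by positivity)]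
    push_cast
    linarith

/-- Each prime `p` divides `n!` at least `⌊n / p⌋` times. -/
lemma div_le_factorization_factorial {p : ℕ} (hp : p.Prime) (n : ℕ) :
    n / p ≤ n.factorial.factorization p := by
  have : Fact p.Prime := ⟨hp⟩
  calc n / p ≤ padicValNat p (p * (n / p)).factorial := by
        rw [padicValNat_factorial_mul]; omega
    _ = (p * (n / p)).factorial.factorization p := (Nat.factorization_def _ hp).symm
    _ ≤ n.factorial.factorization p :=
        (Nat.factorization_le_iff_dvd (Nat.factorial_ne_zero _) (Nat.factorial_ne_zero _)).2
          (Nat.factorial_dvd_factorial (Nat.mul_div_le n p)) p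

lemma sum_log_prime_mul_div_le_log_factorial (n : ℕ) :
    ∑ p ∈ Nat.primesLE n, ((n / p : ℕ) : ℝ) * log p ≤ log (n.factorial : ℝ) := by
  have hsub : Nat.primesLE n ⊆ n.factorial.primeFactors := fun p hp ↦ by
    rw [Nat.mem_primesLE] at hp
    exact Nat.mem_primeFactors.2 ⟨hp.2, (hp.2.dvd_factorial).2 hp.1, Nat.factorial_ne_zero n⟩
  rw [log_nat_eq_sum_factorization, Finsupp.sum, Nat.support_factorization]
  calc ∑ p ∈ Nat.primesLE n, ((n / p : ℕ) : ℝ) * log p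
      ≤ ∑ p ∈ Nat.primesLE n, (n.factorial.factorization p : ℝ) * log p := by
        gcongr with p hp
        exact div_le_factorization_factorial (Nat.prime_of_mem_primesLE hp) n
    _ ≤ _ := sum_le_sum_of_subset_of_nonneg hsub fun p _ _ ↦
        mul_nonneg (Nat.cast_nonneg _) (log_natCast_nonneg p)

lemma sum_log_prime_div_le {n : ℕ} (hn : 1 ≤ n) :
    ∑ p ∈ Nat.primesLE n, log p / p ≤ log n - 1 + (log n + 1) / n + 2 * log 2 := by
  have hn0 : (0 : ℝ) < n := by exact_mod_cast hn
  have htheta := Chebyshev.theta_le_log4_mul_x (x := n) hn0.le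
  rw [Chebyshev.theta_eq_sum_primesLE_log] at htheta
  have hlog4 : log 4 = 2 * log 2 := by
    rw [show (4 : ℝ) = 2 ^ 2 by norm_num, log_pow]; norm_num
  have hmain : n * ∑ p ∈ Nat.primesLE n, log p / p ≤
      ∑ p ∈ Nat.primesLE n, ((n / p : ℕ) : ℝ) * log p + ∑ p ∈ Nat.primesLE n, log p := by
    rw [mul_sum, ← sum_add_distrib]
    refine sum_le_sum fun p hp ↦ ?_
    have hp0 : (0 : ℝ) < p := by exact_mod_cast (Nat.prime_of_mem_primesLE hp).pos
    have hfloor : (n : ℝ) / p ≤ (n / p : ℕ) + 1 := by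
      rw [← Nat.floor_div_eq_div (K := ℝ)]
      exact (Nat.lt_floor_add_one _).le
    calc (n : ℝ) * (log p / p) = n / p * log p := by ring
      _ ≤ ((n / p : ℕ) + 1) * log p :=
          mul_le_mul_of_nonneg_right hfloor (log_natCast_nonneg p)
      _ = _ := by ring
  have hfact := (sum_log_prime_mul_div_le_log_factorial n).trans (log_factorial_le hn)
  rw [← mul_le_mul_iff_right₀ hn0]
  calc _ ≤ n * log n - n + log n + 1 + log 4 * n := by linarith
    _ = _ := by rw [hlog4]; field_simp; ring

lemma sum_log_div_mul_sub_one_le {n : ℕ} (hn : 2 ≤ n) :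
    ∑ m ∈ Icc 2 n, log m / (m * (m - 1)) ≤ log 2 + 1 - (log n + 2) / n := by
  induction n, hn using Nat.le_induction with
  | base => norm_num; linarith
  | succ n hn ih =>
    rw [sum_Icc_succ_top (by omega)]
    have hn0 : (2 : ℝ) ≤ n := by exact_mod_cast hn
    have hratio : log (n + 1) - log n ≤ 1 / n := by
      rw [← log_div (by positivity) (by positivity)]
      have h := log_le_sub_one_of_pos (x := ((n : ℝ) + 1) / n) (by positivity)
      calc _ ≤ _ := h
        _ = _ := by field_simp; ring
    have hmul : (n + 1) * (log (n + 1) - log n) ≤ 2 := by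
      calc ((n : ℝ) + 1) * (log (n + 1) - log n) ≤ (n + 1) * (1 / n) := by gcongr
        _ ≤ 2 := by rw [mul_one_div, div_le_iff₀ (by positivity)]; linarith
    have hkey : log ((n : ℝ) + 1) / ((n + 1) * n) ≤
        (log n + 2) / n - (log (n + 1) + 2) / (n + 1) := by
      rw [div_sub_div _ _ (by positivity) (by positivity), mul_comm ((n : ℝ) + 1) n]
      gcongr
      linarith
    push_cast
    rw [add_sub_cancel_right]
    linarith

/-- An explicit upper bound in the spirit of Mertens' first theorem. -/
lemma sum_log_prime_div_sub_one_le {n : ℕ} (hn : 2 ≤ n) :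
    ∑ p ∈ Nat.primesLE n, log p / (p - 1) ≤ log n + 3 * log 2 := by
  have hn0 : (0 : ℝ) < n := by positivity
  have hsub : Nat.primesLE n ⊆ Icc 2 n := fun p hp ↦ by
    rw [Nat.mem_primesLE] at hp
    exact mem_Icc.2 ⟨hp.2.two_le, hp.1⟩
  have htail : ∑ p ∈ Nat.primesLE n, log p / (p * (p - 1)) ≤ log 2 + 1 - (log n + 2) / n := by
    refine (sum_le_sum_of_subset_of_nonneg hsub fun m hm _ ↦ ?_).trans
      (sum_log_div_mul_sub_one_le hn)
    have hm2 : (2 : ℝ) ≤ m := by exact_mod_cast (mem_Icc.1 hm).1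
    exact div_nonneg (log_natCast_nonneg m) (mul_nonneg (by linarith) (by linarith))
  have hsplit : ∑ p ∈ Nat.primesLE n, log p / (p - 1) =
      ∑ p ∈ Nat.primesLE n, log p / p + ∑ p ∈ Nat.primesLE n, log p / (p * (p - 1)) := by
    rw [← sum_add_distrib]
    refine sum_congr rfl fun p hp ↦ ?_
    have hp2 : (2 : ℝ) ≤ p := by exact_mod_cast (Nat.prime_of_mem_primesLE hp).two_le
    have : (p : ℝ) - 1 ≠ 0 := by linarith
    field_simp
    ring
  have hhead := sum_log_prime_div_le (n := n) (by omega)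
  have hle : (log n + 1) / n ≤ (log n + 2) / n := by gcongr; norm_num
  linarith

lemma sum_log_primeFactors_le {l : ℕ} (hl : l ≠ 0) :
    ∑ p ∈ l.primeFactors, log p ≤ log l := by
  rw [← log_prod fun p hp ↦ by exact_mod_cast (Nat.prime_of_mem_primeFactors hp).ne_zero,
    ← Nat.cast_prod]
  have hdvd := Nat.prod_primeFactors_dvd l
  exact log_le_log (by exact_mod_cast Nat.pos_of_dvd_of_pos hdvd (by omega))
    (by exact_mod_cast Nat.le_of_dvd (by omega) hdvd)

lemma sum_log_primeFactors_div_sub_one_le {l n : ℕ} (hl : l ≠ 0) (hn : 2 ≤ n)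
    (hln : log l ≤ n) :
    ∑ p ∈ l.primeFactors, log p / (p - 1) ≤ log n + 3 * log 2 + 1 := by
  have hn0 : (0 : ℝ) < n := by positivity
  rw [← sum_filter_add_sum_filter_not l.primeFactors (· ≤ n)]
  refine add_le_add ?_ ?_
  · refine (sum_le_sum_of_subset_of_nonneg (fun p hp ↦ ?_) fun p hp _ ↦ ?_).trans
      (sum_log_prime_div_sub_one_le hn)
    · rw [mem_filter] at hp
      exact Nat.mem_primesLE.2 ⟨hp.2, Nat.prime_of_mem_primeFactors hp.1⟩
    · have hp1 : (1 : ℝ) ≤ p := by exact_mod_cast (Nat.prime_of_mem_primesLE hp).one_le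
      exact div_nonneg (log_natCast_nonneg p) (by linarith)
  · calc ∑ p ∈ l.primeFactors with ¬ p ≤ n, log p / ((p : ℝ) - 1)
        ≤ ∑ p ∈ l.primeFactors with ¬ p ≤ n, log p / n := by
          refine sum_le_sum fun p hp ↦ ?_
          have hnp : (n : ℝ) + 1 ≤ p := by exact_mod_cast not_le.1 (mem_filter.1 hp).2
          exact div_le_div_of_nonneg_left (log_natCast_nonneg p) hn0 (by linarith)
      _ ≤ ∑ p ∈ l.primeFactors, log p / n :=
          sum_le_sum_of_subset_of_nonneg (filter_subset _ _) fun p _ _ ↦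
            div_nonneg (log_natCast_nonneg p) hn0.le
      _ ≤ 1 := by
          rw [← sum_div, div_le_one hn0]
          exact (sum_log_primeFactors_le hl).trans hln

end PrimeSums

section EulerProductBound

lemma rpow_neg_one_sub_le {δ x : ℝ} (hδ : 0 < δ) (hx : 0 < x) :
    (x + 1) ^ (-(1 + δ)) ≤ (x ^ (-δ) - (x + 1) ^ (-δ)) / δ := by
  have hx1 : 0 < x + 1 := by linarith
  have hratio : 1 + δ / (x + 1) ≤ (x / (x + 1)) ^ (-δ) := by
    rw [rpow_def_of_pos (by positivity)]
    have hlog := log_le_sub_one_of_pos (x := x / (x + 1)) (by positivity)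
    have heq : x / (x + 1) - 1 = -(1 / (x + 1)) := by field_simp; ring
    have hmul : δ * (1 / (x + 1)) ≤ δ * -log (x / (x + 1)) := by gcongr; linarith
    calc 1 + δ / (x + 1) ≤ log (x / (x + 1)) * -δ + 1 := by
          rw [mul_one_div] at hmul; linarith
      _ ≤ _ := add_one_le_exp _
  have hpow : x ^ (-δ) = (x + 1) ^ (-δ) * (x / (x + 1)) ^ (-δ) := by
    rw [← mul_rpow (by positivity) (by positivity), mul_div_cancel₀ _ hx1.ne']
  rw [le_div_iff₀ hδ, hpow, neg_add', sub_eq_add_neg, add_comm (-1 : ℝ), rpow_add hx1, rpow_neg_one]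
  have hpos : 0 < (x + 1) ^ (-δ) := rpow_pos_of_pos hx1 _
  have := mul_le_mul_of_nonneg_left hratio hpos.le
  calc (x + 1) ^ (-δ) * (x + 1)⁻¹ * δ = (x + 1) ^ (-δ) * (1 + δ / (x + 1)) - (x + 1) ^ (-δ) := by
        ring
    _ ≤ _ := by linarith

lemma sum_range_rpow_neg_le {δ : ℝ} (hδ : 0 < δ) (n : ℕ) :
    ∑ i ∈ range n, (i : ℝ) ^ (-(1 + δ)) ≤ 1 + 1 / δ := by
  have hsucc (n : ℕ) : ∑ i ∈ range (n + 2), (i : ℝ) ^ (-(1 + δ)) ≤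
      1 + 1 / δ - ((n : ℝ) + 1) ^ (-δ) / δ := by
    induction n with
    | zero =>
      have h0 : (0 : ℝ) ^ (-(1 + δ)) = 0 := zero_rpow (by linarith)
      simp [sum_range_succ, -neg_add_rev, h0]
    | succ n ih =>
      rw [sum_range_succ]
      have h := rpow_neg_one_sub_le hδ (x := (n : ℝ) + 1) (by positivity)
      rw [sub_div] at h
      push_cast
      rw [show (n : ℝ) + 2 = n + 1 + 1 by ring]
      linarith
  calc ∑ i ∈ range n, (i : ℝ) ^ (-(1 + δ)) ≤ ∑ i ∈ range (n + 2), (i : ℝ) ^ (-(1 + δ)) :=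
        sum_le_sum_of_subset_of_nonneg (range_mono (by omega)) fun i _ _ ↦ by positivity
    _ ≤ _ := hsucc n
    _ ≤ _ := sub_le_self _ (by positivity)

lemma prod_primes_one_sub_rpow_inv_le {δ : ℝ} (hδ : 0 < δ) {s : Finset ℕ}
    (hs : ∀ p ∈ s, p.Prime) :
    ∏ p ∈ s, (1 - (p : ℝ) ^ (-(1 + δ)))⁻¹ ≤ 1 + 1 / δ := by
  let f : ℕ →* ℝ :=
    { toFun := fun n ↦ (n : ℝ) ^ (-(1 + δ))
      map_one' := by simp
      map_mul' := fun m n ↦ by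
        push_cast
        exact mul_rpow (Nat.cast_nonneg m) (Nat.cast_nonneg n) }
  have hf0 (n : ℕ) : 0 ≤ f n := rpow_nonneg (Nat.cast_nonneg n) _
  have hsum : Summable f := Real.summable_nat_rpow.2 (by linarith)
  have hprod := EulerProduct.prod_filter_prime_geometric_eq_tsum_factoredNumbers hsum s
  rw [filter_true_of_mem hs] at hprod
  calc _ = ∑' m : Nat.factoredNumbers s, f m := hprod
    _ ≤ ∑' m, f m := hsum.tsum_subtype_le f _ hf0
    _ ≤ _ := Real.tsum_le_of_sum_range_le hf0 (sum_range_rpow_neg_le hδ)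

lemma one_sub_rpow_mul_exp_le (δ : ℝ) {x : ℝ} (hx : 1 < x) :
    (1 - x ^ (-(1 + δ))) * exp (-(δ * (log x / (x - 1)))) ≤ 1 - x⁻¹ := by
  have hx0 : 0 < x := by linarith
  have hx1 : 0 < x - 1 := by linarith
  have hpow : 1 - δ * log x ≤ x ^ (-δ) := by
    rw [rpow_def_of_pos hx0]
    linarith [add_one_le_exp (log x * -δ)]
  have hle : 1 - x ^ (-(1 + δ)) ≤ (1 - x⁻¹) * exp (δ * (log x / (x - 1))) := by
    calc 1 - x ^ (-(1 + δ)) = 1 - x⁻¹ * x ^ (-δ) := by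
          rw [neg_add, rpow_add hx0, rpow_neg_one]
      _ ≤ 1 - x⁻¹ * (1 - δ * log x) := by gcongr
      _ = (1 - x⁻¹) * (δ * (log x / (x - 1)) + 1) := by field_simp; ring
      _ ≤ _ := by
          gcongr
          · exact sub_nonneg.2 (inv_le_one_of_one_le₀ hx.le)
          · exact add_one_le_exp _
  rw [exp_neg, ← div_eq_mul_inv, div_le_iff₀ (exp_pos _)]
  exact hle

/-- Rankin's trick: comparing the exponent `1` with `1 + δ` in a finite Euler product. -/
lemma le_prod_primes_one_sub_inv {δ : ℝ} (hδ : 0 < δ) {s : Finset ℕ}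
    (hs : ∀ p ∈ s, p.Prime) :
    exp (-(δ * ∑ p ∈ s, log p / (p - 1))) / (1 + 1 / δ) ≤ ∏ p ∈ s, (1 - (p : ℝ)⁻¹) := by
  have hone (p : ℕ) (hp : p ∈ s) : (1 : ℝ) < p := by exact_mod_cast (hs p hp).one_lt
  have hpos (p : ℕ) (hp : p ∈ s) : 0 < 1 - (p : ℝ) ^ (-(1 + δ)) :=
    sub_pos.2 (rpow_lt_one_of_one_lt_of_neg (hone p hp) (by linarith))
  have hzeta := prod_primes_one_sub_rpow_inv_le hδ hs
  rw [prod_inv_distrib] at hzeta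
  calc exp (-(δ * ∑ p ∈ s, log p / (p - 1))) / (1 + 1 / δ)
      ≤ (∏ p ∈ s, (1 - (p : ℝ) ^ (-(1 + δ)))) * exp (-(δ * ∑ p ∈ s, log p / (p - 1))) := by
        rw [div_eq_inv_mul]
        gcongr
        exact inv_le_of_inv_le₀ (prod_pos hpos) hzeta
    _ = ∏ p ∈ s, (1 - (p : ℝ) ^ (-(1 + δ))) * exp (-(δ * (log p / (p - 1)))) := by
        rw [prod_mul_distrib, mul_sum, ← sum_neg_distrib, exp_sum]
    _ ≤ _ := prod_le_prod (fun p hp ↦ mul_nonneg (hpos p hp).le (exp_pos _).le)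
        fun p hp ↦ one_sub_rpow_mul_exp_le δ (hone p hp)

end EulerProductBound

section Numerics

lemma log_le_div_of_pow_le {x : ℝ} (hx : 0 < x) (a : ℕ) {b : ℕ} (hb : 0 < b)
    (h : x ^ b ≤ 2.7182818283 ^ a) : log x ≤ a / b := by
  have hb0 : (0 : ℝ) < b := by exact_mod_cast hb
  rw [le_div_iff₀ hb0, mul_comm, ← log_pow, log_le_iff_le_exp (by positivity), ← exp_one_pow]
  exact h.trans (by gcongr; exact exp_one_gt_d9.le)

lemma div_le_log_of_pow_le {x : ℝ} (hx : 0 < x) (a : ℕ) {b : ℕ} (hb : 0 < b)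
    (h : 2.7182818286 ^ a ≤ x ^ b) : (a : ℝ) / b ≤ log x := by
  have hb0 : (0 : ℝ) < b := by exact_mod_cast hb
  rw [div_le_iff₀ hb0, mul_comm (log x), ← log_pow, le_log_iff_exp_le (by positivity),
    ← exp_one_pow]
  exact le_trans (by gcongr; exact exp_one_lt_d9.le) h

lemma log_log_six_le : log (log 6) ≤ 59 / 100 := by
  have h6 : log 6 ≤ 9 / 5 := by
    simpa using log_le_div_of_pow_le (x := 6) (by norm_num) 9 (b := 5) (by norm_num) (by norm_num)
  have h : log (9 / 5) ≤ 59 / 100 := by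
    simpa using log_le_div_of_pow_le (x := 9 / 5) (by norm_num) 59 (b := 100) (by norm_num)
      (by norm_num)
  exact (log_le_log (log_pos (by norm_num)) h6).trans h

lemma half_le_log_log {x : ℝ} (hx : 7 ≤ x) : 1 / 2 ≤ log (log x) := by
  have h7 : 7 / 4 ≤ log 7 := by
    simpa using div_le_log_of_pow_le (x := 7) (by norm_num) 7 (b := 4) (by norm_num) (by norm_num)
  have h : 1 / 2 ≤ log (7 / 4) := by
    simpa using div_le_log_of_pow_le (x := 7 / 4) (by norm_num) 1 (b := 2) (by norm_num)
      (by norm_num)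
  exact h.trans (log_le_log (by norm_num) (h7.trans (log_le_log (by norm_num) hx)))

lemma three_quarters_le_log_log {x : ℝ} (hx : 12 ≤ x) : 3 / 4 ≤ log (log x) := by
  have h12 : 12 / 5 ≤ log 12 := by
    simpa using div_le_log_of_pow_le (x := 12) (by norm_num) 12 (b := 5) (by norm_num)
      (by norm_num)
  have h : 3 / 4 ≤ log (12 / 5) := by
    simpa using div_le_log_of_pow_le (x := 12 / 5) (by norm_num) 3 (b := 4) (by norm_num)
      (by norm_num)
  exact h.trans (log_le_log (by norm_num) (h12.trans (log_le_log (by norm_num) hx)))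

end Numerics

section Totient

lemma totient_eq_mul_prod_primeFactors (l : ℕ) :
    (l.totient : ℝ) = l * ∏ p ∈ l.primeFactors, (1 - (p : ℝ)⁻¹) := by
  have h := congrArg (Rat.cast : ℚ → ℝ) (Nat.totient_eq_mul_prod_factors l)
  push_cast at h
  exact h

lemma exp_neg_log_le_one_sub_inv {p : ℕ} (hp : 37 ≤ p) :
    exp (-(log p / 128)) ≤ 1 - (p : ℝ)⁻¹ := by
  have hp37 : (37 : ℝ) ≤ p := by exact_mod_cast hp
  have h37 : 32 / 9 ≤ log 37 := by
    simpa using div_le_log_of_pow_le (x := 37) (by norm_num) 32 (b := 9) (by norm_num)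
      (by norm_num)
  have hlog : 32 / 9 ≤ log p := h37.trans (log_le_log (by norm_num) hp37)
  have hinv : ((p : ℝ) - 1)⁻¹ ≤ log p / 128 := by
    calc ((p : ℝ) - 1)⁻¹ ≤ (36 : ℝ)⁻¹ := inv_anti₀ (by norm_num) (by linarith)
      _ ≤ _ := by linarith
  have hone : 0 < (p : ℝ) - 1 := by linarith
  rw [exp_neg]
  refine inv_le_of_inv_le₀ (sub_pos.2 (inv_lt_one_of_one_lt₀ (by linarith))) ?_
  calc (1 - (p : ℝ)⁻¹)⁻¹ = ((p : ℝ) - 1)⁻¹ + 1 := by field_simp; ring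
    _ ≤ log p / 128 + 1 := by linarith
    _ ≤ _ := add_one_le_exp _

lemma prod_primesLE_le_prod_primeFactors {l : ℕ} (hl : l ≠ 0) :
    (∏ p ∈ Nat.primesLE 31, (1 - (p : ℝ)⁻¹)) * exp (-(log l / 128)) ≤
      ∏ p ∈ l.primeFactors, (1 - (p : ℝ)⁻¹) := by
  have hnonneg {p : ℕ} (hp : p.Prime) : 0 ≤ 1 - (p : ℝ)⁻¹ :=
    sub_nonneg.2 (inv_le_one_of_one_le₀ (by exact_mod_cast hp.one_le))
  rw [← prod_filter_mul_prod_filter_not l.primeFactors (· ≤ 31)]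
  refine mul_le_mul ?_ ?_ (exp_pos _).le
    (prod_nonneg fun p hp ↦ hnonneg (Nat.prime_of_mem_primeFactors (mem_filter.1 hp).1))
  · refine prod_le_prod_of_subset_of_le_one (fun p hp ↦ ?_)
      (fun p hp ↦ hnonneg (Nat.prime_of_mem_primesLE hp)) fun p _ _ ↦ ?_
    · rw [mem_filter] at hp
      exact Nat.mem_primesLE.2 ⟨hp.2, Nat.prime_of_mem_primeFactors hp.1⟩
    · exact sub_le_self _ (by positivity)
  · calc exp (-(log l / 128))
        ≤ exp (∑ p ∈ l.primeFactors with ¬ p ≤ 31, -(log p / 128)) := by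
          have hsub : ∑ p ∈ l.primeFactors with ¬ p ≤ 31, log (p : ℝ) ≤ log l :=
            (sum_le_sum_of_subset_of_nonneg (filter_subset _ _) fun p _ _ ↦
              log_natCast_nonneg p).trans (sum_log_primeFactors_le hl)
          rw [sum_neg_distrib, ← sum_div]
          gcongr
      _ = ∏ p ∈ l.primeFactors with ¬ p ≤ 31, exp (-(log p / 128)) := exp_sum _ _
      _ ≤ _ := by
          refine prod_le_prod (fun p _ ↦ (exp_pos _).le) fun p hp ↦ ?_
          rw [mem_filter] at hp
          refine exp_neg_log_le_one_sub_inv ?_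
          have hprime := Nat.prime_of_mem_primeFactors hp.1
          by_contra hlt
          have hgt : 31 < p := not_le.1 hp.2
          have : p < 37 := not_le.1 hlt
          interval_cases p <;> revert hprime <;> norm_num

lemma le_prod_primeFactors_mul_log_log_of_log_le {l : ℕ} (hl : 210 ≤ l)
    (hle : log (l : ℝ) ≤ 128) :
    59 / 300 ≤ (∏ p ∈ l.primeFactors, (1 - (p : ℝ)⁻¹)) * log (log l) := by
  set y := log (l : ℝ) with hy
  have hy5 : 53 / 10 ≤ y := by
    have h : 53 / 10 ≤ log 210 := by
      simpa using div_le_log_of_pow_le (x := 210) (by norm_num) 53 (b := 10) (by norm_num)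
        (by norm_num)
    exact h.trans (log_le_log (by norm_num) (by exact_mod_cast hl))
  have hsmall : (152 / 1000 : ℝ) ≤ ∏ p ∈ Nat.primesLE 31, (1 - (p : ℝ)⁻¹) := by
    have hset : Nat.primesLE 31 = {2, 3, 5, 7, 11, 13, 17, 19, 23, 29, 31} := by decide
    rw [hset]
    norm_num
  have hprod := prod_primesLE_le_prod_primeFactors (l := l) (by omega)
  rw [← hy] at hprod
  have hcombine {u a b : ℝ} (hyu : y ≤ u) (ha : 0 ≤ a) (hb : 0 ≤ b) (hau : a ≤ exp (-(u / 128)))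
      (hby : b ≤ log y) (hab : 59 / 300 ≤ 152 / 1000 * a * b) :
      59 / 300 ≤ (∏ p ∈ l.primeFactors, (1 - (p : ℝ)⁻¹)) * log y := by
    have hexp : a ≤ exp (-(y / 128)) := hau.trans (exp_le_exp.2 (by linarith))
    have hP : 152 / 1000 * a ≤ ∏ p ∈ l.primeFactors, (1 - (p : ℝ)⁻¹) :=
      (mul_le_mul hsmall hexp ha (le_trans (by norm_num) hsmall)).trans hprod
    exact hab.trans (mul_le_mul hP hby hb (le_trans (by positivity) hP))
  rcases le_total y 20 with h20 | h20
  · have hlog : 83 / 50 ≤ log (53 / 10) := by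
      simpa using div_le_log_of_pow_le (x := 53 / 10) (by norm_num) 83 (b := 50) (by norm_num)
        (by norm_num)
    refine hcombine (a := 1 - 20 / 128) (b := 83 / 50) h20 (by norm_num) (by norm_num) ?_
      (hlog.trans (log_le_log (by norm_num) hy5)) (by norm_num)
    linarith [add_one_le_exp (-(20 / 128) : ℝ)]
  rcases le_total y 80 with h80 | h80
  · have hlog : 29 / 10 ≤ log 20 := by
      simpa using div_le_log_of_pow_le (x := 20) (by norm_num) 29 (b := 10) (by norm_num)
        (by norm_num)
    refine hcombine (a := 1 / 2) (b := 29 / 10) h80 (by norm_num) (by norm_num) ?_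
      (hlog.trans (log_le_log (by norm_num) h20)) (by norm_num)
    rw [← log_le_iff_le_exp (by norm_num), one_div, log_inv]
    linarith [log_two_gt_d9]
  · have hlog : 43 / 10 ≤ log 80 := by
      simpa using div_le_log_of_pow_le (x := 80) (by norm_num) 43 (b := 10) (by norm_num)
        (by norm_num)
    refine hcombine (a := 1 / 3) (b := 43 / 10) hle (by norm_num) (by norm_num) ?_
      (hlog.trans (log_le_log (by norm_num) h80)) (by norm_num)
    rw [div_self (by norm_num), exp_neg, one_div]
    exact inv_anti₀ (exp_pos _) (by linarith [exp_one_lt_d9])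

lemma le_prod_primeFactors_mul_log_log_of_le_log {l : ℕ} (hle : 128 ≤ log (l : ℝ)) :
    59 / 300 ≤ (∏ p ∈ l.primeFactors, (1 - (p : ℝ)⁻¹)) * log (log l) := by
  set y := log (l : ℝ) with hy
  have hl : l ≠ 0 := by
    rintro rfl
    norm_num at hy
    linarith
  have hy0 : 0 < y := by linarith
  have hL : 7 * log 2 ≤ log y := by
    calc 7 * log 2 = log 128 := by
          rw [show (128 : ℝ) = 2 ^ 7 by norm_num, log_pow]; norm_num
      _ ≤ log y := log_le_log (by norm_num) hle
  have hyn : y ≤ (⌈y⌉₊ : ℝ) := Nat.le_ceil y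
  have hn : 2 ≤ ⌈y⌉₊ := by
    have : (2 : ℝ) ≤ (⌈y⌉₊ : ℝ) := by linarith
    exact_mod_cast this
  have hlogn : log (⌈y⌉₊ : ℝ) ≤ log y + 1 / 128 := by
    have h1 : (⌈y⌉₊ : ℝ) ≤ y * (1 + 1 / 128) := by linarith [Nat.ceil_lt_add_one hy0.le]
    have h2 := log_le_sub_one_of_pos (x := 1 + 1 / 128) (by norm_num)
    calc _ ≤ log (y * (1 + 1 / 128)) := log_le_log (by linarith) h1
      _ = log y + log (1 + 1 / 128) := log_mul hy0.ne' (by norm_num)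
      _ ≤ _ := by linarith
  have hsum := sum_log_primeFactors_div_sub_one_le hl hn hyn
  set M := log (⌈y⌉₊ : ℝ) + 3 * log 2 + 1
  have hlog2 := log_two_gt_d9
  have hlog2' := log_two_lt_d9
  have hM : 0 < M := by
    have : 0 ≤ log (⌈y⌉₊ : ℝ) := log_natCast_nonneg _
    positivity
  have hrankin := le_prod_primes_one_sub_inv (δ := 1 / M) (by positivity)
    (fun p hp ↦ Nat.prime_of_mem_primeFactors (n := l) hp)
  have hP : exp (-1) / (1 + M) ≤ ∏ p ∈ l.primeFactors, (1 - (p : ℝ)⁻¹) := by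
    refine le_trans ?_ hrankin
    rw [one_div_one_div]
    gcongr
    rw [one_div_mul_eq_div, div_le_one hM]
    exact hsum
  have hMle : 1 + M ≤ log y + 1 / 128 + 3 * log 2 + 2 := by simp only [M]; linarith
  refine le_trans ?_ (mul_le_mul_of_nonneg_right hP (by linarith))
  rw [exp_neg, inv_div_left, ← div_eq_inv_mul, le_div_iff₀ (by positivity)]
  calc 59 / 300 * ((1 + M) * exp 1)
      ≤ 59 / 300 * ((log y + 1 / 128 + 3 * log 2 + 2) * 2.7182818286) := by
        gcongr
        · linarith
        · exact exp_one_lt_d9.le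
    _ ≤ log y := by linarith

lemma four_mul_le_fifteen_mul_totient {l : ℕ} (hl : l < 210) : 4 * l ≤ 15 * l.totient := by
  revert l
  decide +kernel

lemma two_mul_le_five_mul_totient {l : ℕ} (h7 : 7 ≤ l) (h12 : l < 12) :
    2 * l ≤ 5 * l.totient := by
  interval_cases l <;> decide

lemma le_totient_mul_log_log {l : ℕ} (hl : 7 ≤ l) :
    59 / 300 * (l : ℝ) ≤ l.totient * log (log l) := by
  have hl7 : (7 : ℝ) ≤ l := by exact_mod_cast hl
  rcases lt_or_ge l 12 with h12 | h12
  · have htot : 2 * (l : ℝ) ≤ 5 * l.totient := by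
      exact_mod_cast two_mul_le_five_mul_totient hl h12
    nlinarith [half_le_log_log hl7]
  rcases lt_or_ge l 210 with h210 | h210
  · have htot : 4 * (l : ℝ) ≤ 15 * l.totient := by
      exact_mod_cast four_mul_le_fifteen_mul_totient h210
    nlinarith [three_quarters_le_log_log (x := l) (by exact_mod_cast h12)]
  have hmain : 59 / 300 ≤ (∏ p ∈ l.primeFactors, (1 - (p : ℝ)⁻¹)) * log (log l) := by
    rcases le_total (log (l : ℝ)) 128 with h | h
    · exact le_prod_primeFactors_mul_log_log_of_log_le h210 h
    · exact le_prod_primeFactors_mul_log_log_of_le_log h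
  rw [totient_eq_mul_prod_primeFactors, mul_assoc, mul_comm]
  gcongr

end Totient

/-- For every integer `l ≥ 6`, Euler's totient function satisfies
`φ(l) ln(ln l) ≥ C l` where `C = φ(6) ln(ln 6)/6 = ln(ln 6)/3`. -/
theorem totient_log_log_ge (l : ℕ) (hl : 6 ≤ l) :
    (Nat.totient l : ℝ) * Real.log (Real.log l) ≥ Real.log (Real.log 6) / 3 * l := by
  rcases hl.eq_or_lt with rfl | hlt
  · have h6 : Nat.totient 6 = 2 := by decide
    rw [h6]
    push_cast
    linarith
  · calc log (log 6) / 3 * (l : ℝ) ≤ 59 / 300 * l := by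
          refine mul_le_mul_of_nonneg_right ?_ (Nat.cast_nonneg l)
          linarith [log_log_six_le]
      _ ≤ _ := le_totient_mul_log_log hlt
end

section
/- For an integer l ≥ 3, the inequality ln(2/√3.1) − ln γ(l)/φ(l) ≤ 0 (equivalently, γ(l)² ≥ (4/3.1)^{φ(l)}) holds if and only if l ∈ {3, 4, 5, 7, 8, 9, 11, 13, 17, 19, 23}. -/
theorem gam_prime_pow {p : ℕ} (hp : p.Prime) (k : ℕ) : gam (p ^ (k + 1)) = p := by
  rw [gam, if_pos (hp.isPrimePow.pow k.succ_ne_zero), hp.pow_minFac k.succ_ne_zero]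

theorem log_sub_nonpos_iff {g n : ℕ} (hg : 0 < g) (hn : 0 < n) :
    Real.log (2 / Real.sqrt 3.1) - Real.log g / (n : ℝ) ≤ 0 ↔
      (40 / 31 : ℝ) ^ n ≤ (g : ℝ) ^ 2 := by
  have hn' : (0 : ℝ) < n := by exact_mod_cast hn
  have hg' : (0 : ℝ) < g := by exact_mod_cast hg
  have hlog : Real.log (40 / 31) = 2 * Real.log (2 / Real.sqrt 3.1) := by
    have h : (40 / 31 : ℝ) = (2 / Real.sqrt 3.1) ^ 2 := by
      rw [div_pow, Real.sq_sqrt (by norm_num)]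
      norm_num
    rw [h, Real.log_pow]
    norm_num
  rw [← Real.log_le_log_iff (x := (40 / 31 : ℝ) ^ n) (by positivity) (by positivity), Real.log_pow, Real.log_pow, hlog,
    sub_nonpos, le_div_iff₀ hn']
  push_cast
  constructor <;> intro h <;> linarith

theorem sq_lt_pow_pred {p : ℕ} (hp : 29 ≤ p) : (p : ℝ) ^ 2 < (40 / 31 : ℝ) ^ (p - 1) := by
  induction p, hp using Nat.le_induction with
  | base => norm_num
  | succ n hn ih =>
    have hn' : (29 : ℝ) ≤ n := by exact_mod_cast hn
    obtain ⟨m, rfl⟩ : ∃ m, n = m + 1 := ⟨n - 1, by omega⟩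
    simp only [Nat.add_sub_cancel] at ih ⊢
    rw [pow_succ (40 / 31 : ℝ)]
    push_cast at *
    nlinarith

theorem mem_of_pow_totient_le {p k : ℕ} (hp : p.Prime) (hl : 3 ≤ p ^ (k + 1))
    (h : (40 / 31 : ℝ) ^ (p ^ (k + 1)).totient ≤ (p : ℝ) ^ 2) :
    p ^ (k + 1) ∈ ({3, 4, 5, 7, 8, 9, 11, 13, 17, 19, 23} : Set ℕ) := by
  rw [Nat.totient_prime_pow_succ hp] at h
  have hp29 : p < 29 := by
    by_contra! hge
    refine h.not_gt ((sq_lt_pow_pred hge).trans_le (pow_le_pow_right₀ (by norm_num) ?_))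
    exact Nat.le_mul_of_pos_left _ (pow_pos hp.pos k)
  have htot : p ^ k * (p - 1) < 27 := by
    by_contra! hge
    have hsq : (p : ℝ) ^ 2 ≤ 28 ^ 2 := by
      gcongr
      exact_mod_cast Nat.le_of_lt_succ hp29
    have hpow : (40 / 31 : ℝ) ^ 27 ≤ (40 / 31 : ℝ) ^ (p ^ k * (p - 1)) :=
      pow_le_pow_right₀ (by norm_num) hge
    norm_num at hsq hpow h
    linarith
  have hk5 : k < 5 := by
    by_contra! hge
    have htwo : 2 ^ 5 ≤ p ^ k :=
      (Nat.pow_le_pow_right two_pos hge).trans (Nat.pow_le_pow_left hp.two_le k)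
    have hle := Nat.le_mul_of_pos_right (p ^ k) (Nat.sub_pos_of_lt hp.one_lt)
    omega
  interval_cases k <;> interval_cases p <;> revert hp htot h hl <;> norm_num

theorem pow_totient_le_minFac_sq {l : ℕ}
    (h : l ∈ ({3, 4, 5, 7, 8, 9, 11, 13, 17, 19, 23} : Set ℕ)) :
    (40 / 31 : ℝ) ^ l.totient ≤ (l.minFac : ℝ) ^ 2 := by
  simp only [Set.mem_insert_iff, Set.mem_singleton_iff] at h
  rcases h with rfl | rfl | rfl | rfl | rfl | rfl | rfl | rfl | rfl | rfl | rfl <;>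
    norm_num [Nat.totient_prime, show Nat.totient 4 = 2 from rfl,
      show Nat.totient 8 = 4 from rfl, show Nat.totient 9 = 6 from rfl]

/-- For an integer `l ≥ 3`, `ln(2/√3.1) - ln γ(l)/φ(l) ≤ 0` holds iff
`l ∈ {3, 4, 5, 7, 8, 9, 11, 13, 17, 19, 23}`. -/
theorem exceptional_l_31 (l : ℕ) (hl : 3 ≤ l) :
    Real.log (2 / Real.sqrt 3.1) - Real.log (gam l) / (Nat.totient l : ℝ) ≤ 0 ↔
      l ∈ ({3, 4, 5, 7, 8, 9, 11, 13, 17, 19, 23} : Set ℕ) := by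
  have htot : 0 < l.totient := Nat.totient_pos.2 (by omega)
  by_cases hpp : IsPrimePow l
  · obtain ⟨p, k, hp, hk, rfl⟩ := (isPrimePow_nat_iff l).1 hpp
    obtain ⟨k, rfl⟩ : ∃ j, k = j + 1 := ⟨k - 1, by omega⟩
    rw [gam_prime_pow hp, log_sub_nonpos_iff hp.pos htot]
    refine ⟨mem_of_pow_totient_le hp hl, fun h => ?_⟩
    have hle := pow_totient_le_minFac_sq h
    rwa [hp.pow_minFac k.succ_ne_zero] at hle
  · have hgam : gam l = 1 := if_neg hpp
    rw [hgam, log_sub_nonpos_iff one_pos htot]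
    refine iff_of_false ?_ fun h => hpp ?_
    · rw [Nat.cast_one, one_pow, not_le]
      exact one_lt_pow₀ (by norm_num) htot.ne'
    · simp only [Set.mem_insert_iff, Set.mem_singleton_iff] at h
      rw [isPrimePow_nat_iff]
      rcases h with rfl | rfl | rfl | rfl | rfl | rfl | rfl | rfl | rfl | rfl | rfl
      · exact ⟨3, 1, by norm_num⟩
      · exact ⟨2, 2, by norm_num⟩
      · exact ⟨5, 1, by norm_num⟩
      · exact ⟨7, 1, by norm_num⟩
      · exact ⟨2, 3, by norm_num⟩
      · exact ⟨3, 2, by norm_num⟩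
      · exact ⟨11, 1, by norm_num⟩
      · exact ⟨13, 1, by norm_num⟩
      · exact ⟨17, 1, by norm_num⟩
      · exact ⟨19, 1, by norm_num⟩
      · exact ⟨23, 1, by norm_num⟩
end

section
/- Let b_{13}, b_{14}, b_{23}, b_{24} be real numbers satisfying the equation b_{13}b_{14}b_{23}b_{24} = 8 − 2b_{13}² − 2b_{14}² − 2b_{23}² − 2b_{24}² + (b_{13}²b_{24}² + b_{14}²b_{23}²)/2 together with the four inequalities b_{13}² + b_{23}² < 4, b_{23}² + b_{24}² < 4, b_{24}² + b_{14}² < 4, and b_{14}² + b_{13}² < 4. Then −4 < b_{13}b_{14}b_{23}b_{24} ≤ 1. -/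
/-- Constrained bounds for the quadrangle graph `Γ₁⁽⁵⁾`: if real numbers
`b₁₃, b₁₄, b₂₃, b₂₄` satisfy the Gram determinant equation
`b₁₃b₁₄b₂₃b₂₄ = 8 - 2b₁₃² - 2b₁₄² - 2b₂₃² - 2b₂₄² + (b₁₃²b₂₄² + b₁₄²b₂₃²)/2`
together with `b₁₃² + b₂₃² < 4`, `b₂₃² + b₂₄² < 4`, `b₂₄² + b₁₄² < 4`,
`b₁₄² + b₁₃² < 4`, then `-4 < b₁₃b₁₄b₂₃b₂₄ ≤ 1`. -/
theorem quadrangle_product_bounds (b13 b14 b23 b24 : ℝ)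
    (heq : b13 * b14 * b23 * b24 =
      8 - 2 * b13 ^ 2 - 2 * b14 ^ 2 - 2 * b23 ^ 2 - 2 * b24 ^ 2 +
        (b13 ^ 2 * b24 ^ 2 + b14 ^ 2 * b23 ^ 2) / 2)
    (h1 : b13 ^ 2 + b23 ^ 2 < 4)
    (h2 : b23 ^ 2 + b24 ^ 2 < 4)
    (h3 : b24 ^ 2 + b14 ^ 2 < 4)
    (h4 : b14 ^ 2 + b13 ^ 2 < 4) :
    -4 < b13 * b14 * b23 * b24 ∧ b13 * b14 * b23 * b24 ≤ 1 := by
  constructor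
  · have hx : |b13 * b14| < 2 :=
      abs_lt.2 ⟨by nlinarith [sq_nonneg (b13 + b14)], by nlinarith [sq_nonneg (b13 - b14)]⟩
    have hy : |b23 * b24| < 2 :=
      abs_lt.2 ⟨by nlinarith [sq_nonneg (b23 + b24)], by nlinarith [sq_nonneg (b23 - b24)]⟩
    have hxy : |b13 * b14 * (b23 * b24)| < 2 * 2 := by
      rw [abs_mul]
      exact mul_lt_mul'' hx hy (abs_nonneg _) (abs_nonneg _)
    linarith [(abs_lt.1 hxy).1]
  · -- With `s = b13 * b24 + b14 * b23`, the equation gives `4 * product ≤ (4 - |s|) ^ 2`,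
    -- while `4 * product ≤ s ^ 2` by AM-GM and `|s| < 4`.
    have hs : 2 * |b13 * b24 + b14 * b23| ≤ b13 ^ 2 + b14 ^ 2 + b23 ^ 2 + b24 ^ 2 := by
      rcases abs_cases (b13 * b24 + b14 * b23) with ⟨h, -⟩ | ⟨h, -⟩ <;> rw [h]
      · linarith [sq_nonneg (b13 - b24), sq_nonneg (b14 - b23)]
      · linarith [sq_nonneg (b13 + b24), sq_nonneg (b14 + b23)]
    have hsq := sq_abs (b13 * b24 + b14 * b23)
    have hnonneg := abs_nonneg (b13 * b24 + b14 * b23)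
    generalize |b13 * b24 + b14 * b23| = s at hs hsq hnonneg
    have hAMGM : 4 * (b13 * b14 * b23 * b24) ≤ s ^ 2 := by
      linarith [sq_nonneg (b13 * b24 - b14 * b23)]
    have hGram : 4 * (b13 * b14 * b23 * b24) ≤ (4 - s) ^ 2 := by
      linarith
    rcases le_total s 2 with h | h
    · nlinarith
    · nlinarith
end

section
/- Let b_{13}, b_{14}, b_{24}, b_{25}, b_{35}, c be real numbers satisfying the system 4b_{13}² = (4 − b_{14}²)(4 − b_{35}²), 4b_{25}² = (4 − b_{24}²)(4 − b_{35}²), 4b_{14}² + 4c² + 4c·b_{14}b_{24} = (4 − b_{13}²)(4 − b_{24}²), 4b_{24}² + 4c² + 4c·b_{14}b_{24} = (4 − b_{14}²)(4 − b_{25}²), and b_{35}²(4 − c²) + 2c·b_{13}b_{25}b_{35} + 4c² = (4 − b_{13}²)(4 − b_{25}²), together with b_{13}² < 4, b_{14}² < 4, b_{24}² < 4, b_{25}² < 4, b_{35}² < 4, and c² < 4. Then −3.1 < b_{13}b_{14}b_{24}b_{25}b_{35} < 3.1. -/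
/-- Constrained bounds for the pentagon graph `Γ₄⁽⁶⁾`: if real numbers
`b₁₃, b₁₄, b₂₄, b₂₅, b₃₅, c` satisfy the Gram determinant equations
`4b₁₃² = (4 - b₁₄²)(4 - b₃₅²)`, `4b₂₅² = (4 - b₂₄²)(4 - b₃₅²)`,
`4b₁₄² + 4c² + 4c b₁₄ b₂₄ = (4 - b₁₃²)(4 - b₂₄²)`,
`4b₂₄² + 4c² + 4c b₁₄ b₂₄ = (4 - b₁₄²)(4 - b₂₅²)`,
`b₃₅²(4 - c²) + 2c b₁₃ b₂₅ b₃₅ + 4c² = (4 - b₁₃²)(4 - b₂₅²)`,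
together with `b₁₃², b₁₄², b₂₄², b₂₅², b₃₅², c² < 4`, then
`-3.1 < b₁₃ b₁₄ b₂₄ b₂₅ b₃₅ < 3.1`. -/
theorem pentagon_product_bounds (b13 b14 b24 b25 b35 c : ℝ)
    (e1 : 4 * b13 ^ 2 = (4 - b14 ^ 2) * (4 - b35 ^ 2))
    (e2 : 4 * b25 ^ 2 = (4 - b24 ^ 2) * (4 - b35 ^ 2))
    (e3 : 4 * b14 ^ 2 + 4 * c ^ 2 + 4 * c * b14 * b24 = (4 - b13 ^ 2) * (4 - b24 ^ 2))
    (e4 : 4 * b24 ^ 2 + 4 * c ^ 2 + 4 * c * b14 * b24 = (4 - b14 ^ 2) * (4 - b25 ^ 2))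
    (e5 : b35 ^ 2 * (4 - c ^ 2) + 2 * c * b13 * b25 * b35 + 4 * c ^ 2 =
      (4 - b13 ^ 2) * (4 - b25 ^ 2))
    (h13 : b13 ^ 2 < 4) (h14 : b14 ^ 2 < 4) (h24 : b24 ^ 2 < 4)
    (h25 : b25 ^ 2 < 4) (h35 : b35 ^ 2 < 4) (hc : c ^ 2 < 4) :
    -3.1 < b13 * b14 * b24 * b25 * b35 ∧ b13 * b14 * b24 * b25 * b35 < 3.1 := by
  have hz0 : 0 ≤ b35 ^ 2 := sq_nonneg _
  have hxy : (b14 ^ 2 * (4 - b14 ^ 2)) * (b24 ^ 2 * (4 - b24 ^ 2)) ≤ 4 * 4 := by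
    refine mul_le_mul ?_ ?_ (mul_nonneg (sq_nonneg _) (by linarith)) (by norm_num)
    · nlinarith [sq_nonneg (b14 ^ 2 - 2)]
    · nlinarith [sq_nonneg (b24 ^ 2 - 2)]
  have hz : b35 ^ 2 * (4 - b35 ^ 2) ^ 2 ≤ 256 / 27 := by
    nlinarith [mul_nonneg (sq_nonneg (b35 ^ 2 - 4 / 3)) (by linarith : 0 ≤ 16 / 3 - b35 ^ 2)]
  have key : 16 * (b13 * b14 * b24 * b25 * b35) ^ 2 =
      ((b14 ^ 2 * (4 - b14 ^ 2)) * (b24 ^ 2 * (4 - b24 ^ 2))) *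
        (b35 ^ 2 * (4 - b35 ^ 2) ^ 2) := by
    calc 16 * (b13 * b14 * b24 * b25 * b35) ^ 2
        = (4 * b13 ^ 2) * (4 * b25 ^ 2) * (b14 ^ 2 * b24 ^ 2 * b35 ^ 2) := by ring
      _ = _ := by rw [e1, e2]; ring
  have hprod := mul_le_mul hxy hz (mul_nonneg hz0 (sq_nonneg _)) (by norm_num)
  exact abs_lt.mp (abs_lt_of_sq_lt_sq (by linarith) (by norm_num))
end

section
/- Let k ≥ s ≥ 6 be integers and let K be a totally real number field with ℚ(cos(2π/k), cos(2π/s)) ⊆ K and K = ℚ(α), where α is an algebraic integer such that for every real embedding σ : K → ℝ other than the identity, −8·σ(sin²(π/k) sin²(π/s)) < σ(α) ≤ 2·σ(sin²(π/k) sin²(π/s)), while 5·2³ < α < 32·14³. Then [K : ℚ] ≤ 909. -/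
/-- **Hadamard's inequality**, in terms of bounds on the squared norms of the rows. -/
theorem Matrix.abs_det_le_prod_of_row_sq_le {n : ℕ} (A : Matrix (Fin n) (Fin n) ℝ)
    (b : Fin n → ℝ) (hb : ∀ i, 0 ≤ b i) (h : ∀ i, ∑ j, A i j ^ 2 ≤ b i ^ 2) :
    |A.det| ≤ ∏ i, b i := by
  let e := EuclideanSpace.basisFun (Fin n) ℝ
  have : Fact (Module.finrank ℝ (EuclideanSpace ℝ (Fin n)) = n) := ⟨by simp⟩
  have key := e.toBasis.orientation.abs_volumeForm_apply_le (fun i => WithLp.toLp 2 (A i))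
  rw [Orientation.volumeForm_robust' _ e, Module.Basis.det_apply] at key
  have hA : e.toBasis.toMatrix (fun i => WithLp.toLp 2 (A i)) = A.transpose := by
    ext i j
    simp [e, Module.Basis.toMatrix_apply]
  rw [hA, Matrix.det_transpose] at key
  refine key.trans (Finset.prod_le_prod (fun _ _ => norm_nonneg _) fun i _ => ?_)
  rw [EuclideanSpace.norm_eq]
  refine Real.sqrt_le_iff.2 ⟨hb i, ?_⟩
  simpa using h i

open Polynomial in
/-- The monic polynomials `X ^ (j % 2) * (X ^ 2 - r ^ 2 / 2) ^ (j / 2)` are smaller on `[-r, r]`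
than the monomials `X ^ j`; this gives a bound on Vandermonde determinants, in which one node is
allowed to leave the interval. -/
theorem Matrix.abs_det_vandermonde_le {m : ℕ} (x : Fin m → ℝ) {r R : ℝ} (hr : 0 ≤ r) (hR : 1 ≤ R)
    (w : Fin m → ℝ)
    (hx : ∀ i, (|x i| ≤ r ∧ w i = 1) ∨ (|x i| ≤ R * r ∧ w i = (2 * R) ^ (m - 1))) :
    |(Matrix.vandermonde x).det| ≤
      (∏ j : Fin m, (r ^ (j : ℕ) * (1 / 2) ^ ((j : ℕ) / 2))) * ∏ i, (√m * w i) := by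
  let p : ℕ → ℝ[X] := fun j => X ^ (j % 2) * (X ^ 2 - C (r ^ 2 / 2)) ^ (j / 2)
  have hmonic : (X ^ 2 - C (r ^ 2 / 2) : ℝ[X]).Monic := monic_X_pow_sub_C _ two_ne_zero
  have hp : ∀ j, (p j).Monic := fun j => (monic_X_pow _).mul (hmonic.pow _)
  have hdeg : ∀ j, (p j).natDegree = j := fun j => by
    rw [(monic_X_pow _).natDegree_mul (hmonic.pow _), natDegree_X_pow, hmonic.natDegree_pow,
      natDegree_X_pow_sub_C]
    exact Nat.mod_add_div' j 2 ▸ by omega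
  have hw : ∀ i, 0 ≤ w i := fun i => by
    rcases hx i with h | h <;> rw [h.2] <;> positivity
  let B : ℕ → ℝ := fun j => r ^ j * (1 / 2) ^ (j / 2)
  have hentry : ∀ i (j : Fin m), ∃ y, (p j).eval (x i) = B j * y ∧ |y| ≤ w i := by
    intro i j
    rcases hr.eq_or_lt with rfl | hr0
    · have hx0 : x i = 0 := by rcases hx i with h | h <;> simpa using h.1
      have hone : 1 ≤ w i := by
        rcases hx i with h | h <;> rw [h.2]
        exact one_le_pow₀ (by linarith)
      rcases Nat.eq_zero_or_pos (j : ℕ) with hj | hj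
      · exact ⟨1, by simp [p, B, hj], by simpa using hone⟩
      · refine ⟨0, ?_, by simpa using hw i⟩
        have : (j : ℕ) % 2 ≠ 0 ∨ (j : ℕ) / 2 ≠ 0 := by omega
        rcases this with h | h <;> simp [p, hx0, h]
    · obtain ⟨z, hz⟩ : ∃ z, x i = r * z := ⟨x i / r, by field_simp⟩
      refine ⟨z ^ ((j : ℕ) % 2) * (2 * z ^ 2 - 1) ^ ((j : ℕ) / 2), ?_, ?_⟩
      · have h1 : (r * z) ^ 2 - r ^ 2 / 2 = r ^ 2 * (1 / 2) * (2 * z ^ 2 - 1) := by ring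
        have h2 : r ^ (j : ℕ) = r ^ ((j : ℕ) % 2) * (r ^ 2) ^ ((j : ℕ) / 2) := by
          rw [← pow_mul, ← pow_add, Nat.mod_add_div]
        simp only [p, B, eval_mul, eval_pow, eval_X, eval_sub, eval_C, hz]
        rw [h1, h2]
        simp only [mul_pow]
        ring
      · have hzabs : |x i| = r * |z| := by rw [hz, abs_mul, abs_of_pos hr0]
        rw [abs_mul, abs_pow, abs_pow]
        rcases hx i with ⟨h, h'⟩ | ⟨h, h'⟩
        · have hz1 : |z| ≤ 1 := by
            rw [hzabs] at h
            exact le_of_mul_le_mul_left (by linarith) hr0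
          have hz2 : |2 * z ^ 2 - 1| ≤ 1 := by
            rw [abs_le]
            have := (sq_le_one_iff_abs_le_one z).2 hz1
            constructor <;> nlinarith [sq_nonneg z]
          rw [h']
          exact mul_le_one₀ (pow_le_one₀ (abs_nonneg _) hz1) (by positivity)
            (pow_le_one₀ (abs_nonneg _) hz2)
        · have hz1 : |z| ≤ R := by
            rw [hzabs, mul_comm R] at h
            exact le_of_mul_le_mul_left h hr0
          have hz2 : |2 * z ^ 2 - 1| ≤ (2 * R) ^ 2 := by
            have : z ^ 2 ≤ R ^ 2 := sq_le_sq' (by linarith [neg_le_of_abs_le hz1])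
              (le_of_abs_le hz1)
            rw [abs_le]
            constructor <;> nlinarith [sq_nonneg z]
          rw [h']
          calc |z| ^ ((j : ℕ) % 2) * |2 * z ^ 2 - 1| ^ ((j : ℕ) / 2)
              ≤ (2 * R) ^ ((j : ℕ) % 2) * ((2 * R) ^ 2) ^ ((j : ℕ) / 2) := by
                gcongr
                linarith
            _ = (2 * R) ^ (j : ℕ) := by rw [← pow_mul, ← pow_add, Nat.mod_add_div]
            _ ≤ (2 * R) ^ (m - 1) := pow_le_pow_right₀ (by linarith) (by omega)
  choose y hy hyw using hentry
  have hmat : (Matrix.of fun i j : Fin m => (p j).eval (x i)) =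
      Matrix.of fun i j : Fin m => B j * (Matrix.of y) i j := by
    ext i j
    simp [hy]
  rw [Matrix.det_eval_matrixOfPolynomials_eq_det_vandermonde x (fun j => p j) (fun j => hdeg j)
    (fun j => hp j), hmat, Matrix.det_mul_row, abs_mul, Finset.abs_prod]
  refine mul_le_mul (le_of_eq (Finset.prod_congr rfl fun j _ => abs_of_nonneg (by positivity)))
    (Matrix.abs_det_le_prod_of_row_sq_le _ _ (fun i => mul_nonneg (by positivity) (hw i))
      fun i => ?_) (abs_nonneg _) (Finset.prod_nonneg fun j _ => by positivity)
  calc ∑ j, y i j ^ 2 ≤ ∑ _j : Fin m, w i ^ 2 :=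
        Finset.sum_le_sum fun j _ => sq_le_sq' (by linarith [neg_le_of_abs_le (hyw i j)])
          (le_of_abs_le (hyw i j))
    _ = (√m * w i) ^ 2 := by
        rw [mul_pow, Real.sq_sqrt (Nat.cast_nonneg m)]
        simp

theorem mul_sub_two_le_four_mul_sum_div_two (m : ℕ) :
    m * (m - 2) ≤ 4 * ∑ j ∈ Finset.range m, j / 2 := by
  induction m using Nat.twoStepInduction with
  | zero => simp
  | one => simp
  | more m ih _ =>
    rw [Finset.sum_range_succ, Finset.sum_range_succ]
    obtain ⟨a, rfl | rfl⟩ := Nat.even_or_odd' m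
    · have h1 : 2 * a / 2 = a := by omega
      have h2 : (2 * a + 1) / 2 = a := by omega
      rw [h1, h2]
      rcases a with _ | a
      · simp
      · have e1 : 2 * (a + 1) - 2 = 2 * a := by omega
        have e2 : 2 * (a + 1) + 2 - 2 = 2 * (a + 1) := by omega
        rw [e1] at ih
        rw [e2]
        nlinarith
    · have h1 : (2 * a + 1) / 2 = a := by omega
      have h2 : (2 * a + 1 + 1) / 2 = a + 1 := by omega
      rw [h1, h2]
      rcases a with _ | a
      · simp
      · have e1 : 2 * (a + 1) + 1 - 2 = 2 * a + 1 := by omega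
        have e2 : 2 * (a + 1) + 1 + 2 - 2 = 2 * (a + 1) + 1 := by omega
        rw [e1] at ih
        rw [e2]
        nlinarith

theorem Matrix.det_vandermonde_pow_four_le {m : ℕ} (x : Fin m → ℝ) {r R : ℝ} (hr : 0 ≤ r)
    (hR : 1 ≤ R) (w : Fin m → ℝ)
    (hx : ∀ i, (|x i| ≤ r ∧ w i = 1) ∨ (|x i| ≤ R * r ∧ w i = (2 * R) ^ (m - 1))) :
    (Matrix.vandermonde x).det ^ 4 ≤
      (m : ℝ) ^ (2 * m) * (1 / 2) ^ (m * (m - 2)) * r ^ (2 * (m * (m - 1))) * (∏ i, w i) ^ 4 := by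
  have h := Matrix.abs_det_vandermonde_le x hr hR w hx
  have hw : 0 ≤ ∏ i, w i := Finset.prod_nonneg fun i _ => by
    rcases hx i with h | h <;> rw [h.2] <;> positivity
  have h4 := pow_le_pow_left₀ (abs_nonneg _) h 4
  rw [show |(Matrix.vandermonde x).det| ^ 4 = (Matrix.vandermonde x).det ^ 4 from
    Even.pow_abs (by decide) _] at h4
  refine h4.trans (le_of_eq_of_le ?_ (mul_le_mul_of_nonneg_right (mul_le_mul_of_nonneg_right
    (mul_le_mul_of_nonneg_left (pow_le_pow_of_le_one (by norm_num) (by norm_num)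
      (mul_sub_two_le_four_mul_sum_div_two m)) (by positivity)) (by positivity)) (by positivity)))
  rw [Fin.prod_univ_eq_prod_range (fun j => r ^ j * (1 / 2 : ℝ) ^ (j / 2)) m,
    Finset.prod_mul_distrib, Finset.prod_mul_distrib, Finset.prod_pow_eq_pow_sum,
    Finset.prod_pow_eq_pow_sum, ← Finset.sum_range_id_mul_two, Finset.prod_const, Finset.card_univ,
    Fintype.card_fin]
  have hs : (√(m : ℝ) ^ m) ^ 4 = (m : ℝ) ^ (2 * m) := by
    rw [← pow_mul, show m * 4 = 2 * (2 * m) by ring, pow_mul, Real.sq_sqrt (Nat.cast_nonneg m)]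
  rw [mul_pow, mul_pow, mul_pow, hs]
  ring

section

open IntermediateField Module

variable {F K : Type*} [Field F] [Field K] [NumberField F] [NumberField K] [Algebra F K]

theorem norm_algebraMap_discr_pow_le [Algebra F ℂ] (α : K) (b : Basis (Fin (finrank F K)) F K)
    (hb : ∀ i, b i = α ^ (i : ℕ)) (hreal : ∀ (φ : K →ₐ[F] ℂ) x, (φ x).im = 0)
    (c h : F) {R : ℝ} (hR : 1 ≤ R) (w : (K →ₐ[F] ℂ) → ℝ)
    (hw : ∀ φ : K →ₐ[F] ℂ,
      (‖φ (α - algebraMap F K c)‖ ≤ ‖algebraMap F ℂ h‖ ∧ w φ = 1) ∨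
      (‖φ (α - algebraMap F K c)‖ ≤ R * ‖algebraMap F ℂ h‖ ∧
        w φ = (2 * R) ^ (finrank F K - 1))) :
    ‖algebraMap F ℂ (Algebra.discr F b)‖ ^ 2 ≤
      (finrank F K : ℝ) ^ (2 * finrank F K) *
        (1 / 2) ^ (finrank F K * (finrank F K - 2)) *
        ‖algebraMap F ℂ h‖ ^ (2 * (finrank F K * (finrank F K - 1))) * (∏ φ, w φ) ^ 4 := by
  have hcard : Fintype.card (Fin (finrank F K)) = Fintype.card (K →ₐ[F] ℂ) := by
    rw [Fintype.card_fin, AlgHom.card]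
  let e : Fin (finrank F K) ≃ (K →ₐ[F] ℂ) := Fintype.equivOfCardEq hcard
  let x : Fin (finrank F K) → ℝ := fun i => (e i (α - algebraMap F K c)).re
  have hx : ∀ i, ((x i : ℝ) : ℂ) = e i α - algebraMap F ℂ c := fun i => by
    have : ((x i : ℝ) : ℂ) = e i (α - algebraMap F K c) :=
      Complex.ext (by simp [x]) (by simp only [Complex.ofReal_im, hreal])
    rw [this, map_sub, AlgHom.commutes]
  have hdet : algebraMap F ℂ (Algebra.discr F b) =
      (((Matrix.vandermonde x).det ^ 2 : ℝ) : ℂ) := by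
    have h1 : Algebra.embeddingsMatrixReindex F ℂ b e =
        (Matrix.vandermonde fun i => e i α).transpose := by
      ext i j
      simp [Algebra.embeddingsMatrixReindex, Algebra.embeddingsMatrix_apply, hb,
        Matrix.vandermonde_apply]
    rw [Algebra.discr_eq_det_embeddingsMatrixReindex_pow_two F ℂ b e, h1, Matrix.det_transpose,
      ← Matrix.det_vandermonde_sub _ (algebraMap F ℂ c), Complex.ofReal_pow]
    congr 1
    rw [← Complex.ofRealHom_eq_coe, RingHom.map_det]
    congr 1
    ext i j
    simp [Matrix.vandermonde_apply, hx]
  have hbound := Matrix.det_vandermonde_pow_four_le x (norm_nonneg (algebraMap F ℂ h)) hR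
    (fun i => w (e i)) fun i => by
      have : |x i| = ‖e i (α - algebraMap F K c)‖ := by
        rw [map_sub, AlgHom.commutes, ← hx, Complex.norm_real, Real.norm_eq_abs]
      rw [this]
      exact hw (e i)
  rw [hdet, Complex.norm_real, Real.norm_eq_abs, sq_abs, ← pow_mul]
  rwa [e.prod_comp] at hbound

end

section

open IntermediateField Module

theorem NumberField.prod_norm_embeddings {F : Type*} [Field F] [NumberField F] (x : F) :
    ∏ τ : F →+* ℂ, ‖τ x‖ = |(Algebra.norm ℚ x : ℝ)| := by
  have h := congrArg (‖·‖) (Algebra.norm_eq_prod_embeddings ℚ ℂ x)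
  simp only [norm_prod] at h
  rw [Fintype.prod_equiv (RingHom.equivRatAlgHom F ℂ) (fun τ : F →+* ℂ => ‖τ x‖) (fun f => ‖f x‖)
    (fun τ => rfl), ← h]
  simp

theorem NumberField.one_le_abs_norm_of_isIntegral {F : Type*} [Field F] [NumberField F] {x : F}
    (hx : IsIntegral ℤ x) (h0 : x ≠ 0) : 1 ≤ |(Algebra.norm ℚ x : ℝ)| := by
  obtain ⟨z, hz⟩ := IsIntegrallyClosed.isIntegral_iff.1 (Algebra.isIntegral_norm ℚ hx)
  have hz0 : z ≠ 0 := by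
    rintro rfl
    exact (Algebra.norm_ne_zero_iff (R := ℚ).2 h0) (by rw [← hz, map_zero])
  rw [← hz]
  simpa using mod_cast Int.one_le_abs hz0

variable {F K : Type*} [Field F] [Field K] [NumberField F] [NumberField K] [Algebra F K]

open Classical in
/-- If all but one of the conjugates of a primitive integral element `α` of a totally real
extension `K / F` lie in the intervals with centres and radii the conjugates of `c` and `h`, then
the relative discriminant of `α` bounds the norm of `h` from below. -/
theorem one_le_of_relative_discr (α : K) (hα : IsIntegral ℤ α) (hgen : F⟮α⟯ = ⊤)
    (hreal : ∀ (σ : K →+* ℂ) x, (σ x).im = 0) (σ₀ : K →+* ℂ) (c h : F) {R : ℝ} (hR : 1 ≤ R)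
    (hσ : ∀ σ : K →+* ℂ, σ ≠ σ₀ →
      ‖σ (α - algebraMap F K c)‖ ≤ ‖σ (algebraMap F K h)‖)
    (hσ₀ : ‖σ₀ (α - algebraMap F K c)‖ ≤ R * ‖σ₀ (algebraMap F K h)‖) :
    1 ≤ ((finrank F K : ℝ) ^ (2 * finrank F K) *
        (1 / 2) ^ (finrank F K * (finrank F K - 2))) ^ finrank ℚ F *
        |(Algebra.norm ℚ h : ℝ)| ^ (2 * (finrank F K * (finrank F K - 1))) *
        (2 * R) ^ (4 * (finrank F K - 1)) := by
  set m := finrank F K with hm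
  have hdeg : (minpoly F α).natDegree = m :=
    (Field.primitive_element_iff_minpoly_natDegree_eq F α).1 hgen
  have : Nonempty (Fin m) := ⟨⟨0, finrank_pos⟩⟩
  have hli : LinearIndependent F fun i : Fin m => α ^ (i : ℕ) := hdeg ▸ linearIndependent_pow α
  let b : Basis (Fin m) F K := basisOfLinearIndependentOfCardEqFinrank hli (by simp [hm])
  have hb : ∀ i, b i = α ^ (i : ℕ) := fun i => by simp [b]
  have hdiscr : IsIntegral ℤ (Algebra.discr F b) :=
    Algebra.discr_isIntegral F fun i => hb i ▸ hα.pow _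
  have hone := NumberField.one_le_abs_norm_of_isIntegral hdiscr (Algebra.discr_not_zero_of_basis F b)
  rw [← NumberField.prod_norm_embeddings] at hone
  have hR1 : 1 ≤ (2 * R) ^ (m - 1) := one_le_pow₀ (by linarith)
  have hτ : ∀ τ : F →+* ℂ, ‖τ (Algebra.discr F b)‖ ^ 2 ≤
      (m : ℝ) ^ (2 * m) * (1 / 2) ^ (m * (m - 2)) * ‖τ h‖ ^ (2 * (m * (m - 1))) *
        (if σ₀.comp (algebraMap F K) = τ then (2 * R) ^ (m - 1) else 1) ^ 4 := by
    intro τ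
    let : Algebra F ℂ := τ.toAlgebra
    have hmap : ∀ y, algebraMap F ℂ y = τ y := fun y => rfl
    let w : (K →ₐ[F] ℂ) → ℝ := fun φ =>
      if (φ : K →+* ℂ) = σ₀ then (2 * R) ^ (m - 1) else 1
    have hh : ∀ φ : K →ₐ[F] ℂ, ‖(φ : K →+* ℂ) (algebraMap F K h)‖ = ‖algebraMap F ℂ h‖ :=
      fun φ => by simp
    have key := norm_algebraMap_discr_pow_le α b hb (fun φ y => hreal (φ : K →+* ℂ) y) c h hR w
      (fun φ => by
        by_cases hφ : (φ : K →+* ℂ) = σ₀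
        · refine Or.inr ⟨?_, if_pos hφ⟩
          rw [← hh φ]
          have := hσ₀
          rw [← hφ] at this
          exact this
        · refine Or.inl ⟨?_, if_neg hφ⟩
          rw [← hh φ]
          exact hσ _ hφ)
    have hw0 : 0 ≤ ∏ φ, w φ := Finset.prod_nonneg fun φ _ => by
      simp only [w]
      split_ifs <;> positivity
    have hwle : ∏ φ, w φ ≤ if σ₀.comp (algebraMap F K) = τ then (2 * R) ^ (m - 1) else 1 := by
      by_cases hex : ∃ φ₀ : K →ₐ[F] ℂ, (φ₀ : K →+* ℂ) = σ₀
      · obtain ⟨φ₀, hφ₀⟩ := hex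
        have h1 : σ₀.comp (algebraMap F K) = τ := by
          ext y
          rw [← hφ₀]
          simp [hmap]
        rw [if_pos h1, Finset.prod_eq_single φ₀]
        · simp [w, hφ₀]
        · intro φ _ hne
          refine if_neg fun hφ => hne ?_
          rw [← hφ₀] at hφ
          exact AlgHom.coe_ringHom_injective hφ
        · simp
      · push Not at hex
        rw [Finset.prod_eq_one fun φ _ => if_neg (hex φ)]
        split_ifs
        · exact hR1
        · exact le_rfl
    simp only [hmap] at key
    refine key.trans ?_
    gcongr
  have hprod := Finset.prod_le_prod (fun τ _ => by positivity) fun τ (_ : τ ∈ Finset.univ) => hτ τ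
  rw [Finset.prod_pow] at hprod
  refine (one_le_pow₀ hone (n := 2)).trans (hprod.trans (le_of_eq ?_))
  rw [Finset.prod_mul_distrib, Finset.prod_mul_distrib, Finset.prod_pow, Finset.prod_pow,
    Finset.prod_ite_eq, NumberField.prod_norm_embeddings, Finset.prod_const, Finset.card_univ,
    NumberField.Embeddings.card, if_pos (Finset.mem_univ _), ← pow_mul, mul_comm (m - 1) 4]

end

section

open IntermediateField Module Polynomial

theorem IntermediateField.norm_adjoinSimple_gen {F M : Type*} [Field F] [Field M] [Algebra F M]
    {z : M} (hz : IsIntegral F z) :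
    Algebra.norm F (AdjoinSimple.gen F z) =
      (-1) ^ (minpoly F z).natDegree * (minpoly F z).coeff 0 := by
  have h := Algebra.PowerBasis.norm_gen_eq_coeff_zero_minpoly (adjoin.powerBasis hz)
  rw [← PowerBasis.natDegree_minpoly] at h
  have hgen : (adjoin.powerBasis hz).gen = AdjoinSimple.gen F z := adjoin.powerBasis_gen hz
  rwa [hgen, minpoly_gen] at h

/-- Norms of elements with the same minimal polynomial agree up to the degrees of the fields. -/
theorem Algebra.norm_pow_finrank_eq_of_minpoly_eq {F E L : Type*} [Field F] [Field E] [Field L]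
    [Algebra F E] [Algebra F L] [FiniteDimensional F E] [FiniteDimensional F L]
    [Algebra.IsSeparable F E] [Algebra.IsSeparable F L] {x : L} {y : E}
    (h : minpoly F x = minpoly F y) :
    Algebra.norm F x ^ finrank F E = Algebra.norm F y ^ finrank F L := by
  have hx : IsIntegral F x := Algebra.IsIntegral.isIntegral x
  have hy : IsIntegral F y := Algebra.IsIntegral.isIntegral y
  have hgen : Algebra.norm F (AdjoinSimple.gen F x) = Algebra.norm F (AdjoinSimple.gen F y) := by
    rw [norm_adjoinSimple_gen hx, norm_adjoinSimple_gen hy, h]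
  have hdeg : finrank F F⟮x⟯ = finrank F F⟮y⟯ := by
    rw [adjoin.finrank hx, adjoin.finrank hy, h]
  rw [Algebra.norm_eq_norm_adjoin F x, Algebra.norm_eq_norm_adjoin F y, hgen, ← pow_mul,
    ← pow_mul, ← finrank_mul_finrank F F⟮x⟯ L, ← finrank_mul_finrank F F⟮y⟯ E, hdeg]
  congr 1
  ring

variable {L : Type*} [Field L] [NumberField L] {t : L} {σ : L →+* ℂ} {k : ℕ} {ζ : ℂ}

theorem IsPrimitiveRoot.norm_pow_totient_eq_of_isCyclotomicExtension (E : Type*) [Field E]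
    [CharZero E] [NeZero k] [IsCyclotomicExtension {k} ℚ E] (hζ : IsPrimitiveRoot ζ k) (hk : 2 < k)
    (ht : σ t = (1 - ζ) * (1 - ζ⁻¹)) :
    Algebra.norm ℚ t ^ k.totient = ((((cyclotomic k ℤ).eval 1 : ℤ) : ℚ) ^ 2) ^ finrank ℚ L := by
  have : NumberField E := IsCyclotomicExtension.numberField {k} ℚ E
  have hirr := cyclotomic.irreducible_rat (n := k) (by omega)
  set z := IsCyclotomicExtension.zeta k ℚ E with hzdef
  have hz : IsPrimitiveRoot z k := IsCyclotomicExtension.zeta_spec k ℚ _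
  obtain ⟨τ, hτ⟩ : ∃ τ : E →ₐ[ℚ] ℂ, τ z = ζ := by
    refine ⟨(hz.powerBasis ℚ).lift ζ ?_, ?_⟩
    · rw [IsPrimitiveRoot.powerBasis_gen, ← cyclotomic_eq_minpoly_rat hz (by omega),
        cyclotomic_eq_minpoly_rat hζ (by omega), minpoly.aeval]
    · exact (congrArg _ (hz.powerBasis_gen ℚ).symm).trans (PowerBasis.lift_gen _ _ _)
  have hnorm : Algebra.norm ℚ ((z - 1) * (z⁻¹ - 1)) = (((cyclotomic k ℤ).eval 1 : ℤ) : ℚ) ^ 2 := by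
    rw [map_mul, hz.sub_one_norm_eq_eval_cyclotomic hk hirr,
      hz.inv.sub_one_norm_eq_eval_cyclotomic hk hirr, sq]
  have hmin : minpoly ℚ t = minpoly ℚ ((z - 1) * (z⁻¹ - 1)) := by
    rw [← minpoly.algHom_eq σ.toRatAlgHom σ.injective t,
      ← minpoly.algHom_eq τ τ.injective ((z - 1) * (z⁻¹ - 1))]
    congr 1
    have : σ.toRatAlgHom t = σ t := rfl
    rw [this, ht, map_mul, map_sub, map_sub, map_inv₀, hτ, map_one]
    ring
  rw [← hnorm, ← Algebra.norm_pow_finrank_eq_of_minpoly_eq hmin,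
    IsCyclotomicExtension.Rat.finrank k]

theorem IsPrimitiveRoot.norm_pow_totient_eq (hζ : IsPrimitiveRoot ζ k) (hk : 2 < k)
    (ht : σ t = (1 - ζ) * (1 - ζ⁻¹)) :
    Algebra.norm ℚ t ^ k.totient = ((((cyclotomic k ℤ).eval 1 : ℤ) : ℚ) ^ 2) ^ finrank ℚ L := by
  have : NeZero k := ⟨by omega⟩
  have : IsCyclotomicExtension {k} ℚ (CyclotomicField k ℚ) :=
    CyclotomicField.isCyclotomicExtension k ℚ
  exact hζ.norm_pow_totient_eq_of_isCyclotomicExtension (CyclotomicField k ℚ) hk ht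

theorem IsPrimitiveRoot.two_mul_finrank_adjoin_eq (hζ : IsPrimitiveRoot ζ k) (hk : 2 < k)
    (hreal : ∀ x, (σ x).im = 0) (ht : σ t = (1 - ζ) * (1 - ζ⁻¹)) :
    2 * finrank ℚ ℚ⟮t⟯ = k.totient := by
  have hk0 : 0 < k := by omega
  have hζ0 : ζ ≠ 0 := hζ.ne_zero (by omega)
  have hζint : IsIntegral ℚ ζ := (hζ.isIntegral hk0).tower_top
  have hφ : finrank ℚ ℚ⟮ζ⟯ = k.totient := by
    rw [adjoin.finrank hζint, ← cyclotomic_eq_minpoly_rat hζ hk0, natDegree_cyclotomic]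
  set v : L →ₐ[ℚ] ℂ := σ.toRatAlgHom
  set E : IntermediateField ℚ ℂ := ℚ⟮t⟯.map v with hE
  have hEdeg : finrank ℚ ℚ⟮t⟯ = finrank ℚ E :=
    (ℚ⟮t⟯.equivMap v).toLinearEquiv.finrank_eq
  have hEreal : ∀ x ∈ E, x.im = 0 := by
    rintro _ ⟨y, -, rfl⟩
    exact hreal y
  have htE : σ t ∈ E := ⟨t, mem_adjoin_simple_self ℚ t, rfl⟩
  have hEadj : E = ℚ⟮σ t⟯ := by
    rw [hE, adjoin_map, Set.image_singleton]
    rfl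
  have hle : E ≤ ℚ⟮ζ⟯ := by
    rw [hEadj, adjoin_simple_le_iff, ht]
    have := mem_adjoin_simple_self ℚ ζ
    exact mul_mem (sub_mem (one_mem _) this) (sub_mem (one_mem _) (inv_mem this))
  have hζE : ζ ∉ E := fun h => by
    have him := hEreal ζ h
    have hnorm : ‖ζ‖ = 1 := Complex.norm_eq_one_of_pow_eq_one hζ.pow_eq_one (by omega)
    have hre : ζ.re ^ 2 = 1 := by
      rw [← Complex.sq_norm_sub_sq_im, hnorm, him]; norm_num
    have : ζ ^ 2 = 1 := by
      apply Complex.ext <;> simp [sq, him] ; nlinarith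
    have := Nat.le_of_dvd (by norm_num) (hζ.dvd_of_pow_eq_one 2 this)
    omega
  have hζint' : IsIntegral E ζ := hζint.tower_top
  have htower : (E⟮ζ⟯).restrictScalars ℚ = ℚ⟮ζ⟯ := by
    apply le_antisymm
    · have h : E⟮ζ⟯ ≤ extendScalars hle := by
        rw [adjoin_simple_le_iff, mem_extendScalars]
        exact mem_adjoin_simple_self ℚ ζ
      exact h
    · rw [adjoin_simple_le_iff]
      exact mem_adjoin_simple_self E ζ
  have hdeg : finrank E E⟮ζ⟯ = 2 := by
    apply le_antisymm
    · rw [adjoin.finrank hζint']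
      set q : E[X] := X ^ 2 + C (⟨σ t, htE⟩ - 2) * X + C 1 with hq
      have hq2 : q.natDegree = 2 := by rw [hq]; compute_degree!
      have hq0 : q ≠ 0 := fun h => by simp [h] at hq2
      rw [← hq2]
      refine natDegree_le_of_dvd (minpoly.dvd E ζ ?_) hq0
      have h2 : algebraMap E ℂ (⟨σ t, htE⟩ - 2) = (1 - ζ) * (1 - ζ⁻¹) - 2 := by
        rw [← ht, map_sub, map_ofNat]; rfl
      rw [hq, map_add, map_add, map_mul, map_pow, aeval_X, aeval_C, aeval_C, h2, map_one]
      field_simp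
      ring
    · have hpos : 0 < finrank E E⟮ζ⟯ := by
        rw [adjoin.finrank hζint']
        exact minpoly.natDegree_pos hζint'
      have hne : finrank E E⟮ζ⟯ ≠ 1 := fun h => by
        rw [finrank_adjoin_simple_eq_one_iff, mem_bot] at h
        obtain ⟨y, hy⟩ := h
        exact hζE (hy ▸ y.2)
      omega
  rw [← hφ, ← htower, hEdeg, mul_comm, ← hdeg]
  exact finrank_mul_finrank ℚ E E⟮ζ⟯

end

section

open Polynomial

theorem Nat.le_two_mul_totient_sq (n : ℕ) :
    (Odd n → n ≤ n.totient ^ 2) ∧ n ≤ 2 * n.totient ^ 2 := by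
  induction n using Nat.recOnPosPrimePosCoprime with
  | prime_pow p a hp ha =>
    obtain ⟨b, rfl⟩ : ∃ b, a = b + 1 := ⟨a - 1, by omega⟩
    rw [Nat.totient_prime_pow_succ hp]
    have hb : p ^ b ≤ (p ^ b) ^ 2 := Nat.le_self_pow two_ne_zero _
    rcases hp.eq_two_or_odd' with rfl | hodd
    · refine ⟨fun h => ?_, ?_⟩
      · simp [Nat.odd_iff, pow_succ] at h
      · rw [pow_succ]
        simpa using by omega
    · have h3 : 3 ≤ p := by
        have := hp.two_le
        rcases hodd with ⟨c, rfl⟩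
        omega
      have hp1 : p ≤ (p - 1) ^ 2 := by
        obtain ⟨c, rfl⟩ : ∃ c, p = c + 3 := ⟨p - 3, by omega⟩
        simp only [show c + 3 - 1 = c + 2 by omega]
        nlinarith
      have : p ^ (b + 1) ≤ (p ^ b * (p - 1)) ^ 2 := by
        rw [mul_pow, pow_succ]
        exact Nat.mul_le_mul hb hp1
      exact ⟨fun _ => this, by omega⟩
  | zero => simp
  | one => simp
  | coprime a b ha hb hab iha ihb =>
    rw [Nat.totient_mul hab, mul_pow]
    refine ⟨fun h => ?_, ?_⟩
    · rw [Nat.odd_mul] at h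
      exact Nat.mul_le_mul (iha.1 h.1) (ihb.1 h.2)
    · rcases Nat.even_or_odd a with he | ho
      · have hob : Odd b := by
          rw [← Nat.not_even_iff_odd]
          intro heb
          have := Nat.dvd_gcd he.two_dvd heb.two_dvd
          rw [hab] at this
          omega
        calc a * b ≤ (2 * a.totient ^ 2) * b.totient ^ 2 := Nat.mul_le_mul iha.2 (ihb.1 hob)
          _ = _ := by ring
      · calc a * b ≤ a.totient ^ 2 * (2 * b.totient ^ 2) := Nat.mul_le_mul (iha.1 ho) ihb.2
          _ = _ := by ring

theorem Polynomial.eval_one_cyclotomic_eq_one_or {k : ℕ} (hk : 2 ≤ k) :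
    (cyclotomic k ℤ).eval 1 = 1 ∨
      ∃ p a : ℕ, p.Prime ∧ k = p ^ (a + 1) ∧ (cyclotomic k ℤ).eval 1 = p := by
  by_cases h : ∀ {p : ℕ}, p.Prime → ∀ a : ℕ, p ^ a ≠ k
  · exact Or.inl (eval_one_cyclotomic_not_prime_pow h)
  · push Not at h
    obtain ⟨p, hp, a, rfl⟩ := h
    rcases a with _ | a
    · simp at hk
    · have : Fact p.Prime := ⟨hp⟩
      exact Or.inr ⟨p, a, hp, rfl, eval_one_cyclotomic_prime_pow a⟩

theorem Polynomial.eval_one_cyclotomic_sq_le_of_dvd {k p a b : ℕ} (hk : 2 ≤ k) (hp : 2 ≤ p)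
    (hpk : p ∣ k) (hb : 0 < b) (h : p ^ 2 * b ^ k.totient ≤ a ^ k.totient) :
    (((cyclotomic k ℤ).eval 1 : ℤ) : ℝ) ^ 2 ≤ ((a : ℝ) / b) ^ k.totient := by
  have hp1 : (1 : ℝ) ≤ p := by exact_mod_cast (by omega : 1 ≤ p)
  have hle : (((cyclotomic k ℤ).eval 1 : ℤ) : ℝ) ^ 2 ≤ (p : ℝ) ^ 2 := by
    rcases eval_one_cyclotomic_eq_one_or hk with h1 | ⟨q, e, hq, rfl, h1⟩
    · rw [h1]; push_cast; nlinarith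
    · rw [h1]
      have := Nat.minFac_le_of_dvd hp hpk
      rw [hq.pow_minFac (by omega)] at this
      push_cast
      gcongr
  refine hle.trans ?_
  rw [div_pow, le_div_iff₀ (by positivity)]
  exact_mod_cast h

/-- Growth of `c ^ k` against a multiple of a power of `k`, from one value of `k` on. -/
theorem Nat.mul_cast_pow_le_pow_of_le {c C : ℝ} {d m : ℕ} (hC : 0 ≤ C)
    (hm : C * (m : ℝ) ^ d ≤ c ^ m) (hstep : ((m : ℝ) + 1) ^ d ≤ c * (m : ℝ) ^ d) (hm0 : 0 < m)
    {k : ℕ} (hk : m ≤ k) : C * (k : ℝ) ^ d ≤ c ^ k := by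
  have hm' : (0 : ℝ) < m := by exact_mod_cast hm0
  have hc : 0 ≤ c := nonneg_of_mul_nonneg_left ((by positivity : (0 : ℝ) ≤ _).trans hstep)
    (by positivity)
  induction k, hk using Nat.le_induction with
  | base => exact hm
  | succ k hk ih =>
    have hk' : (m : ℝ) ≤ k := by exact_mod_cast hk
    have hk0 : (0 : ℝ) < k := hm'.trans_le hk'
    have hratio : ((k : ℝ) + 1) / k ≤ ((m : ℝ) + 1) / m := by
      rw [div_le_div_iff₀ hk0 hm']
      nlinarith
    have hstep' : ((k : ℝ) + 1) ^ d ≤ c * (k : ℝ) ^ d := by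
      rw [← div_le_iff₀ (by positivity), ← div_pow] at hstep ⊢
      exact (pow_le_pow_left₀ (by positivity) hratio d).trans hstep
    push_cast
    calc C * ((k : ℝ) + 1) ^ d ≤ C * (c * (k : ℝ) ^ d) := by gcongr
      _ = c * (C * (k : ℝ) ^ d) := by ring
      _ ≤ c * c ^ k := by gcongr
      _ = c ^ (k + 1) := by ring

theorem Polynomial.eval_one_cyclotomic_sq_le_of_growth {c : ℝ} {k : ℕ} (hc : 1 ≤ c) (hk : 2 ≤ k)
    (hgrow : (k : ℝ) ^ 2 ≤ c ^ (k - 1)) :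
    (((cyclotomic k ℤ).eval 1 : ℤ) : ℝ) ^ 2 ≤ c ^ k.totient := by
  rcases eval_one_cyclotomic_eq_one_or hk with h | ⟨p, a, hp, rfl, h⟩
  · rw [h]
    simpa using one_le_pow₀ hc
  · rw [h, Nat.totient_prime_pow_succ hp]
    push_cast
    rcases a with _ | a
    · simpa using hgrow
    · have hexp : p ^ (a + 1 + 1) - 1 ≤ p ^ (a + 1) * (p - 1) * 2 := by
        obtain ⟨q, rfl⟩ : ∃ q, p = q + 2 := ⟨p - 2, by have := hp.two_le; omega⟩
        rw [show q + 2 - 1 = q + 1 by omega, pow_succ _ (a + 1)]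
        have : 0 ≤ (q + 2) ^ (a + 1) * q := Nat.zero_le _
        have h2 : (q + 2) ^ (a + 1) * (q + 2) ≤ (q + 2) ^ (a + 1) * (q + 1) * 2 := by nlinarith
        omega
      have hp1 : (1 : ℝ) ≤ p := by exact_mod_cast hp.one_lt.le
      have hsq : ((p : ℝ) ^ 2) ^ 2 ≤ (c ^ (p ^ (a + 1) * (p - 1))) ^ 2 := by
        calc ((p : ℝ) ^ 2) ^ 2 ≤ ((p : ℝ) ^ (a + 1 + 1)) ^ 2 := by
              gcongr 1
              exact pow_le_pow_right₀ hp1 (by omega)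
          _ ≤ c ^ (p ^ (a + 1 + 1) - 1) := by exact_mod_cast hgrow
          _ ≤ c ^ (p ^ (a + 1) * (p - 1) * 2) := pow_le_pow_right₀ hc hexp
          _ = _ := pow_mul _ _ _
      exact (pow_le_pow_iff_left₀ (by positivity) (by positivity) two_ne_zero).1 hsq

/-- A rate `c`, in thousandths, for which `Φ_k(1) ^ 2 ≤ c ^ φ(k)`. -/
def cyclotomicRate (k : ℕ) : ℕ :=
  if k = 6 then 1000 else if k = 7 then 1914 else if k = 11 then 1616 else if k < 11 then 1443
  else if k < 14 then 1534 else if k < 24 then 1426 else if k < 500 then 1274 else 1060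

theorem exists_dvd_mul_pow_le_cyclotomicRate_pow : ∀ k ∈ Finset.Ico 7 29, ∃ p ∈ Finset.Ico 2 29,
    p ∣ k ∧ p ^ 2 * 1000 ^ k.totient ≤ cyclotomicRate k ^ k.totient := by
  decide +kernel

set_option exponentiation.threshold 1000 in
theorem Polynomial.eval_one_cyclotomic_sq_le {k : ℕ} (hk : 6 ≤ k) :
    (((cyclotomic k ℤ).eval 1 : ℤ) : ℝ) ^ 2 ≤ ((cyclotomicRate k : ℝ) / 1000) ^ k.totient := by
  have hgrow {c : ℝ} {m : ℕ} (hm : 1 < m) (hc : 1 ≤ c) (h1 : c * (m : ℝ) ^ 2 ≤ c ^ m)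
      (h2 : ((m : ℝ) + 1) ^ 2 ≤ c * (m : ℝ) ^ 2) (hmk : m ≤ k) :
      (((cyclotomic k ℤ).eval 1 : ℤ) : ℝ) ^ 2 ≤ c ^ k.totient := by
    refine eval_one_cyclotomic_sq_le_of_growth hc (by omega) ?_
    have := Nat.mul_cast_pow_le_pow_of_le (by positivity) h1 h2 (by omega) hmk
    obtain ⟨j, rfl⟩ : ∃ j, k = j + 1 := ⟨k - 1, by omega⟩
    rw [pow_succ' _ j] at this
    exact le_of_mul_le_mul_left this (by positivity)
  rcases eq_or_ne k 6 with rfl | h6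
  · have h : (cyclotomic 6 ℤ).eval 1 = 1 := by
      rw [cyclotomic_six]; norm_num
    rw [h]; norm_num [cyclotomicRate]
  rcases lt_or_ge k 29 with h29 | h29
  · obtain ⟨p, hp, hpk, h⟩ :=
      exists_dvd_mul_pow_le_cyclotomicRate_pow k (Finset.mem_Ico.2 ⟨by omega, h29⟩)
    exact_mod_cast eval_one_cyclotomic_sq_le_of_dvd (by omega) (Finset.mem_Ico.1 hp).1 hpk
      (by norm_num) h
  rcases lt_or_ge k 500 with h500 | h500
  · have : cyclotomicRate k = 1274 := by unfold cyclotomicRate; split_ifs <;> omega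
    rw [this]
    exact hgrow (m := 29) (by norm_num) (by norm_num) (by norm_num) (by norm_num) h29
  · have : cyclotomicRate k = 1060 := by unfold cyclotomicRate; split_ifs <;> omega
    rw [this]
    exact hgrow (m := 500) (by norm_num) (by norm_num) (by norm_num) (by norm_num) h500

end

section

open IntermediateField Module

variable {L : Type*} [Field L] [NumberField L] {t u : L} {σ₀ : L →+* ℂ} {k s : ℕ} {ζ ξ : ℂ}

theorem IsPrimitiveRoot.abs_norm_le_cyclotomicRate_pow (hζ : IsPrimitiveRoot ζ k) (hk : 6 ≤ k)
    (ht : σ₀ t = (1 - ζ) * (1 - ζ⁻¹)) :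
    |(Algebra.norm ℚ t : ℝ)| ≤ ((cyclotomicRate k : ℝ) / 1000) ^ finrank ℚ L := by
  have hφ : k.totient ≠ 0 := (Nat.totient_pos.2 (by omega)).ne'
  have h := congrArg (fun q : ℚ => |(q : ℝ)|) (hζ.norm_pow_totient_eq (by omega) ht)
  simp only [Rat.cast_pow, abs_pow, Rat.cast_intCast, sq_abs] at h
  refine (pow_le_pow_iff_left₀ (abs_nonneg _) (by positivity) hφ).1 ?_
  rw [h, ← pow_mul _ (finrank ℚ L), mul_comm (finrank ℚ L), pow_mul]
  exact pow_le_pow_left₀ (by positivity) (Polynomial.eval_one_cyclotomic_sq_le hk) _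

open Classical in
theorem NumberField.one_le_of_embeddings_le {x y : L} (hx : IsIntegral ℤ x) (h0 : x ≠ 0)
    {B r : ℝ} (hσ : ∀ σ : L →+* ℂ, σ ≠ σ₀ → ‖σ x‖ ≤ r * ‖σ y‖ ^ 2)
    (hσ₀ : ‖σ₀ x‖ ≤ B * (r * ‖σ₀ y‖ ^ 2)) :
    1 ≤ B * (r ^ finrank ℚ L * |(Algebra.norm ℚ y : ℝ)| ^ 2) := by
  have hcard : Fintype.card (L →+* ℂ) = finrank ℚ L := NumberField.Embeddings.card L ℂ
  calc (1 : ℝ) ≤ |(Algebra.norm ℚ x : ℝ)| := one_le_abs_norm_of_isIntegral hx h0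
    _ = ‖σ₀ x‖ * ∏ σ ∈ Finset.univ.erase σ₀, ‖σ x‖ := by
      rw [← prod_norm_embeddings,
        Finset.mul_prod_erase Finset.univ (fun σ : L →+* ℂ => ‖σ x‖) (Finset.mem_univ σ₀)]
    _ ≤ (B * (r * ‖σ₀ y‖ ^ 2)) * ∏ σ ∈ Finset.univ.erase σ₀, (r * ‖σ y‖ ^ 2) := by
      refine mul_le_mul hσ₀ (Finset.prod_le_prod (fun _ _ => norm_nonneg _) fun σ h => ?_)
        (Finset.prod_nonneg fun _ _ => norm_nonneg _) ((norm_nonneg _).trans hσ₀)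
      exact hσ σ (Finset.ne_of_mem_erase h)
    _ = B * ∏ σ : L →+* ℂ, (r * ‖σ y‖ ^ 2) := by
      rw [mul_assoc,
        Finset.mul_prod_erase Finset.univ (fun σ : L →+* ℂ => r * ‖σ y‖ ^ 2) (Finset.mem_univ σ₀)]
    _ = _ := by
      rw [Finset.prod_mul_distrib, Finset.prod_const, Finset.card_univ, hcard, Finset.prod_pow,
        prod_norm_embeddings]

/-- The bound given by the relative discriminant over a subfield of degree at most `33`. -/
theorem one_le_of_relative_discr_of_finrank_le {α c h : L} (F : IntermediateField ℚ L)
    (hF : finrank ℚ F ≤ 33) (hc : c ∈ F) (hh : h ∈ F) (hα : IsIntegral ℤ α) (hgen : ℚ⟮α⟯ = ⊤)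
    (hreal : ∀ (σ : L →+* ℂ) x, (σ x).im = 0) {R q : ℝ} (hR : 1 ≤ R)
    (hσ : ∀ σ : L →+* ℂ, σ ≠ σ₀ → ‖σ (α - c)‖ ≤ ‖σ h‖) (hσ₀ : ‖σ₀ (α - c)‖ ≤ R * ‖σ₀ h‖)
    (hnorm : |(Algebra.norm ℚ h : ℝ)| ≤ q ^ finrank ℚ L) (hn : 910 ≤ finrank ℚ L) :
    1 ≤ (1.32 * q ^ 2 / 2) ^ finrank ℚ L * (2 * R) ^ 4 := by
  have hmul := finrank_mul_finrank ℚ F L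
  have key := one_le_of_relative_discr (F := F) α hα (adjoin_eq_top_of_adjoin_eq_top ℚ hgen) hreal
    σ₀ ⟨c, hc⟩ ⟨h, hh⟩ hR hσ hσ₀
  have hNF : |(Algebra.norm ℚ (⟨h, hh⟩ : F) : ℝ)| ^ finrank F L = |(Algebra.norm ℚ h : ℝ)| := by
    have h1 : Algebra.norm F h = (⟨h, hh⟩ : F) ^ finrank F L :=
      Algebra.norm_algebraMap (⟨h, hh⟩ : F)
    rw [← Algebra.norm_norm (S := F) (a := h), h1, map_pow, Rat.cast_pow, abs_pow]
  generalize finrank ℚ L = n at *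
  generalize finrank ℚ F = d at *
  generalize |(Algebra.norm ℚ (⟨h, hh⟩ : F) : ℝ)| = N at *
  have hm28 : 28 ≤ finrank F L := by
    by_contra! hlt
    have : d * finrank F L ≤ 33 * 27 := Nat.mul_le_mul hF (by omega)
    omega
  obtain ⟨i, hi⟩ : ∃ i, finrank F L = i + 2 := ⟨finrank F L - 2, by omega⟩
  rw [hi] at key hNF hm28 hmul
  simp only [Nat.add_sub_cancel, show i + 2 - 1 = i + 1 by omega] at key
  have hgrow : 2 * ((i + 2 : ℕ) : ℝ) ^ 2 ≤ (1.32 : ℝ) ^ (i + 1) := by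
    have := Nat.mul_cast_pow_le_pow_of_le (c := 1.32) (C := 2.64) (d := 2) (m := 28)
      (by norm_num) (by norm_num) (by norm_num) (by norm_num) hm28
    rw [pow_succ' _ (i + 1)] at this
    refine le_of_mul_le_mul_left (le_trans (le_of_eq ?_) this) (by norm_num : (0 : ℝ) < 1.32)
    ring
  have hfirst : (((i + 2 : ℕ) : ℝ) ^ (2 * (i + 2)) * (1 / 2) ^ ((i + 2) * i)) ^ d ≤
      ((1.32 / 2 : ℝ) ^ n) ^ (i + 1) := by
    have heq : ((i + 2 : ℕ) : ℝ) ^ (2 * (i + 2)) * (1 / 2) ^ ((i + 2) * i) =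
        (2 * ((i + 2 : ℕ) : ℝ) ^ 2 * (1 / 2) ^ (i + 1)) ^ (i + 2) := by
      rw [mul_comm (i + 2) i, pow_mul _ 2, pow_mul _ i, ← mul_pow]
      congr 1
      ring
    rw [heq, ← pow_mul, mul_comm (i + 2) d, hmul, ← pow_mul, mul_comm n, pow_mul]
    refine pow_le_pow_left₀ (by positivity) ?_ n
    calc 2 * ((i + 2 : ℕ) : ℝ) ^ 2 * (1 / 2) ^ (i + 1) ≤ 1.32 ^ (i + 1) * (1 / 2) ^ (i + 1) := by
          gcongr
      _ = _ := by rw [← mul_pow]; norm_num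
  have hsecond : N ^ (2 * ((i + 2) * (i + 1))) ≤ ((q ^ n) ^ 2) ^ (i + 1) := by
    have : N ^ (2 * ((i + 2) * (i + 1))) = ((N ^ (i + 2)) ^ 2) ^ (i + 1) := by ring
    rw [this, hNF]
    gcongr
  have hZ : (1 : ℝ) ≤ ((1.32 * q ^ 2 / 2) ^ n * (2 * R) ^ 4) ^ (i + 1) := by
    refine key.trans ?_
    calc _ ≤ ((1.32 / 2 : ℝ) ^ n) ^ (i + 1) * ((q ^ n) ^ 2) ^ (i + 1) *
          (2 * R) ^ (4 * (i + 1)) := by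
          gcongr
          · rw [show 2 * ((i + 2) * (i + 1)) = (i + 2) * (i + 1) * 2 by ring, pow_mul]
            positivity
      _ = _ := by
        rw [pow_mul _ 4, ← mul_pow, ← mul_pow, ← pow_mul q, mul_comm n 2, pow_mul q, ← mul_pow]
        congr 3
        ring
  exact (one_le_pow_iff_of_nonneg (by positivity) (by omega)).1 hZ

end

section

open IntermediateField Module

theorem RingHom.exists_eq_ofRealHom_comp {L : Type*} [Ring L] (σ : L →+* ℂ)
    (h : ∀ x, (σ x).im = 0) : ∃ ρ : L →+* ℝ, σ = Complex.ofRealHom.comp ρ := by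
  refine ⟨{ toFun x := (σ x).re
            map_one' := ?_
            map_mul' := ?_
            map_zero' := ?_
            map_add' := ?_ }, RingHom.ext fun x => Complex.ext rfl ?_⟩
  all_goals simp [h]

theorem mul_cyclotomicRate_le_or_totient_mul_totient_le :
    ∀ k ∈ Finset.Ico 6 24, ∀ s ∈ Finset.Icc 6 k,
      cyclotomicRate k * cyclotomicRate s ≤ 2360000 ∨ k.totient * s.totient ≤ 132 := by
  decide +kernel

theorem cyclotomicRate_le (k : ℕ) : cyclotomicRate k ≤ 1914 := by
  unfold cyclotomicRate
  split_ifs <;> norm_num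

/-- If `x ≤ r` and `n ≥ 910`, then `C * x ^ n < 1` follows from the case `x = r`, `n = 910`. -/
theorem mul_pow_lt_one_of_le {C x r : ℝ} {n : ℕ} (hC : 0 ≤ C) (hx : 0 ≤ x) (hxr : x ≤ r)
    (hr : r ≤ 1) (hn : 910 ≤ n) (h : C * r ^ 910 < 1) : C * x ^ n < 1 :=
  calc C * x ^ n ≤ C * r ^ n := by gcongr
    _ ≤ C * r ^ 910 := by
      gcongr C * ?_
      exact pow_le_pow_of_le_one (hx.trans hxr) hr hn
    _ < 1 := h

set_option exponentiation.threshold 1000 in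
theorem norm_bound_lt_one {k s n : ℕ} (hn : 910 ≤ n) (hkn : k ≤ 8 * n ^ 2)
    (hrate : 24 ≤ k ∨ cyclotomicRate k * cyclotomicRate s ≤ 2360000) :
    1506100 * (k : ℝ) ^ 8 *
      (5 / 32 * (cyclotomicRate k / 1000 * (cyclotomicRate s / 1000)) ^ 2) ^ n < 1 := by
  have hs' : (cyclotomicRate s : ℝ) ≤ 1914 := by exact_mod_cast cyclotomicRate_le s
  rcases lt_or_ge k 24 with h24 | h24
  · have hprod : (cyclotomicRate k : ℝ) * cyclotomicRate s ≤ 2360000 := by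
      exact_mod_cast hrate.resolve_left (by omega)
    have hk : (k : ℝ) ≤ 23 := by exact_mod_cast (by omega : k ≤ 23)
    refine mul_pow_lt_one_of_le (r := 5 / 32 * 2.36 ^ 2) (by positivity) (by positivity) ?_
      (by norm_num) hn ?_
    · gcongr
      rw [div_mul_div_comm, div_le_iff₀ (by norm_num)]
      linarith
    · calc _ ≤ 1506100 * (23 : ℝ) ^ 8 * (5 / 32 * 2.36 ^ 2) ^ 910 := by gcongr
        _ < 1 := by norm_num
  rcases lt_or_ge k 500 with h500 | h500
  · have hk : (k : ℝ) ≤ 500 := by exact_mod_cast h500.le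
    have hck : cyclotomicRate k = 1274 := by unfold cyclotomicRate; split_ifs <;> omega
    rw [hck]
    refine mul_pow_lt_one_of_le (r := 5 / 32 * (1.274 * 1.914) ^ 2) (by positivity)
      (by positivity) ?_ (by norm_num) hn ?_
    · gcongr
      · norm_num
      · linarith
    · calc _ ≤ 1506100 * (500 : ℝ) ^ 8 * (5 / 32 * (1.274 * 1.914) ^ 2) ^ 910 := by gcongr
        _ < 1 := by norm_num
  · have hck : cyclotomicRate k = 1060 := by unfold cyclotomicRate; split_ifs <;> omega
    have hgrow := Nat.mul_cast_pow_le_pow_of_le (c := 1.5) (C := 1506101 * 8 ^ 8) (d := 16)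
      (m := 910) (by norm_num) (by norm_num) (by norm_num) (by norm_num) hn
    have hkn' : (k : ℝ) ≤ 8 * (n : ℝ) ^ 2 := by exact_mod_cast hkn
    rw [hck]
    have hn0 : (0 : ℝ) < n := by exact_mod_cast (by omega : 0 < n)
    calc _ ≤ 1506100 * (8 * (n : ℝ) ^ 2) ^ 8 * (1 / 1.5) ^ n := by
          gcongr
          calc 5 / 32 * (((1060 : ℕ) : ℝ) / 1000 * (cyclotomicRate s / 1000)) ^ 2 ≤
                5 / 32 * (((1060 : ℕ) : ℝ) / 1000 * (1914 / 1000)) ^ 2 := by gcongr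
            _ ≤ _ := by norm_num
      _ < 1506101 * 8 ^ 8 * (n : ℝ) ^ 16 * (1 / 1.5) ^ n := by
          rw [mul_pow, ← pow_mul, ← mul_assoc]
          gcongr
          norm_num
      _ ≤ 1.5 ^ n * (1 / 1.5) ^ n := by gcongr
      _ = 1 := by rw [← mul_pow]; norm_num

end

section

open IntermediateField Module

theorem IsPrimitiveRoot.isIntegral_of_map_eq {L : Type*} [Field L] {t : L} {σ : L →+* ℂ} {k : ℕ} {ζ : ℂ}
    (hζ : IsPrimitiveRoot ζ k) (hk : 0 < k) (ht : σ t = (1 - ζ) * (1 - ζ⁻¹)) :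
    IsIntegral ℤ t := by
  refine (isIntegral_algHom_iff σ.toIntAlgHom σ.injective).1 ?_
  change IsIntegral ℤ (σ t)
  rw [ht]
  exact (isIntegral_one.sub (hζ.isIntegral hk)).mul (isIntegral_one.sub (hζ.inv.isIntegral hk))

set_option exponentiation.threshold 1000 in
theorem finrank_le_of_conjugates_le {L : Type*} [Field L] [NumberField L] {t u α : L}
    (ρ₀ : L →+* ℝ)
    (hreal : ∀ (σ : L →+* ℂ) x, (σ x).im = 0) {k s : ℕ} (hs : 6 ≤ s) (hks : s ≤ k) {ζ ξ : ℂ}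
    (hζ : IsPrimitiveRoot ζ k) (hξ : IsPrimitiveRoot ξ s)
    (ht : (ρ₀ t : ℂ) = (1 - ζ) * (1 - ζ⁻¹)) (hu : (ρ₀ u : ℂ) = (1 - ξ) * (1 - ξ⁻¹))
    (hα : IsIntegral ℤ α) (hgen : ℚ⟮α⟯ = ⊤)
    (hlow : 256 ≤ (k : ℝ) ^ 4 * ρ₀ (t * u)) (hup : ρ₀ (t * u) ≤ 16)
    (hρ : ∀ ρ : L →+* ℝ, ρ ≠ ρ₀ → -(1 / 2) * ρ (t * u) < ρ α ∧ ρ α ≤ 1 / 8 * ρ (t * u))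
    (hgeo : 40 < ρ₀ α ∧ ρ₀ α < 87808) : finrank ℚ L ≤ 909 := by
  by_contra! hlt
  have hn : 910 ≤ finrank ℚ L := hlt
  set σ₀ : L →+* ℂ := Complex.ofRealHom.comp ρ₀ with hσ₀
  have hk : 6 ≤ k := hs.trans hks
  have hk0 : (0 : ℝ) < k := by exact_mod_cast (by omega : 0 < k)
  have hw0 : 0 < ρ₀ (t * u) := (pos_iff_pos_of_mul_pos (lt_of_lt_of_le (by norm_num) hlow)).1 (by positivity)
  have hconj : ∀ σ : L →+* ℂ, σ ≠ σ₀ → ∃ ρ : L →+* ℝ, ρ ≠ ρ₀ ∧ ∀ x, ‖σ x‖ = |ρ x| := by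
    intro σ hσ
    obtain ⟨ρ, rfl⟩ := σ.exists_eq_ofRealHom_comp (hreal σ)
    exact ⟨ρ, fun h => hσ (by rw [h]), fun x => Complex.norm_real _⟩
  have hnorm₀ : ∀ x, ‖σ₀ x‖ = |ρ₀ x| := fun x => Complex.norm_real _
  have hNt := hζ.abs_norm_le_cyclotomicRate_pow (σ₀ := σ₀) hk ht
  have hNu := hξ.abs_norm_le_cyclotomicRate_pow (σ₀ := σ₀) hs hu
  have hNw : |(Algebra.norm ℚ (t * u) : ℝ)| ≤
      ((cyclotomicRate k : ℝ) / 1000 * (cyclotomicRate s / 1000)) ^ finrank ℚ L := by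
    rw [map_mul, Rat.cast_mul, abs_mul, mul_pow]
    gcongr
  have hDt := hζ.two_mul_finrank_adjoin_eq (σ := σ₀) (by omega) (hreal σ₀) ht
  have hDu := hξ.two_mul_finrank_adjoin_eq (σ := σ₀) (by omega) (hreal σ₀) hu
  by_cases hrate : 24 ≤ k ∨ cyclotomicRate k * cyclotomicRate s ≤ 2360000
  · have hkn : k ≤ 8 * finrank ℚ L ^ 2 := by
      have h1 : finrank ℚ ℚ⟮t⟯ ≤ finrank ℚ L := ℚ⟮t⟯.toSubmodule.finrank_le
      have h2 : k.totient ^ 2 ≤ (2 * finrank ℚ L) ^ 2 := Nat.pow_le_pow_left (by omega) 2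
      have h3 := k.le_two_mul_totient_sq.2
      rw [mul_pow] at h2
      omega
    have hx : IsIntegral ℤ (α * (α + α + t * u)) :=
      hα.mul ((hα.add hα).add ((hζ.isIntegral_of_map_eq (σ := σ₀) (by omega) ht).mul
        (hξ.isIntegral_of_map_eq (σ := σ₀) (by omega) hu)))
    have hxρ : ∀ ρ : L →+* ℝ, ρ (α * (α + α + t * u)) = ρ α * (ρ α + ρ α + ρ (t * u)) := by
      intro ρ; simp
    have hx0 : α * (α + α + t * u) ≠ 0 := fun h => by
      have := hxρ ρ₀
      rw [h, map_zero] at this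
      nlinarith
    have key := NumberField.one_le_of_embeddings_le (σ₀ := σ₀) (y := t * u)
      (B := 1506100 * (k : ℝ) ^ 8) (r := 5 / 32) hx hx0 ?_ ?_
    · refine (norm_bound_lt_one hn hkn hrate).not_ge (key.trans ?_)
      rw [mul_pow, ← pow_mul, mul_comm 2, pow_mul]
      gcongr
    · intro σ hσ
      obtain ⟨ρ, hρne, hρσ⟩ := hconj σ hσ
      obtain ⟨h1, h2⟩ := hρ ρ hρne
      rw [hρσ, hρσ, hxρ, sq_abs, abs_le]
      constructor
      · nlinarith [sq_nonneg (ρ α + ρ (t * u) / 4)]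
      · nlinarith
    · rw [hnorm₀, hnorm₀, hxρ, sq_abs, abs_of_pos (by nlinarith)]
      have h1 : 256 ^ 2 ≤ ((k : ℝ) ^ 4 * ρ₀ (t * u)) ^ 2 := by gcongr
      calc ρ₀ α * (ρ₀ α + ρ₀ α + ρ₀ (t * u)) ≤ 87808 * (87808 + 87808 + 16) := by
            gcongr <;> linarith
        _ ≤ 1506100 * (5 / 32) * 256 ^ 2 := by norm_num
        _ ≤ 1506100 * (5 / 32) * ((k : ℝ) ^ 4 * ρ₀ (t * u)) ^ 2 := by gcongr
        _ = _ := by ring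
  · push Not at hrate
    have hφ := (mul_cyclotomicRate_le_or_totient_mul_totient_le k
      (Finset.mem_Ico.2 ⟨hk, hrate.1⟩) s (Finset.mem_Icc.2 ⟨hs, hks⟩)).resolve_left
      (by omega)
    have hF : finrank ℚ ↥(ℚ⟮t⟯ ⊔ ℚ⟮u⟯) ≤ 33 := by
      refine (finrank_sup_le _ _).trans ?_
      rw [← hDt, ← hDu] at hφ
      nlinarith
    have hwF : t * u ∈ ℚ⟮t⟯ ⊔ ℚ⟮u⟯ :=
      mul_mem ((le_sup_left : ℚ⟮t⟯ ≤ _) (mem_adjoin_simple_self ℚ t))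
        ((le_sup_right : ℚ⟮u⟯ ≤ _) (mem_adjoin_simple_self ℚ u))
    have hmem (r : ℚ) : algebraMap ℚ L r * (t * u) ∈ ℚ⟮t⟯ ⊔ ℚ⟮u⟯ :=
      mul_mem (IntermediateField.algebraMap_mem _ r) hwF
    have hρmul (ρ : L →+* ℝ) (r : ℚ) : ρ (algebraMap ℚ L r * (t * u)) = r * ρ (t * u) := by
      rw [map_mul]; simp
    have hk23 : (k : ℝ) ≤ 23 := by exact_mod_cast (by omega : k ≤ 23)
    have key := one_le_of_relative_discr_of_finrank_le (σ₀ := σ₀) (R := 308000000)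
      (q := 5 / 16 * 1.914 ^ 2) (ℚ⟮t⟯ ⊔ ℚ⟮u⟯) hF (hmem (-3 / 16)) (hmem (5 / 16)) hα hgen hreal
      (by norm_num) ?_ ?_ ?_ hn
    · rw [mul_comm] at key
      refine (mul_pow_lt_one_of_le (r := 0.866) (by positivity) (by positivity) (by norm_num)
        (by norm_num) hn ?_).not_ge key
      norm_num
    · intro σ hσ
      obtain ⟨ρ, hρne, hρσ⟩ := hconj σ hσ
      obtain ⟨h1, h2⟩ := hρ ρ hρne
      rw [hρσ, hρσ, map_sub, hρmul, hρmul]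
      push_cast
      rw [abs_of_pos (a := 5 / 16 * ρ (t * u)) (by linarith), abs_le]
      constructor <;> linarith
    · rw [hnorm₀, hnorm₀, map_sub, hρmul, hρmul]
      push_cast
      have h1 : 256 ≤ (23 : ℝ) ^ 4 * ρ₀ (t * u) := hlow.trans (by gcongr)
      rw [abs_of_pos (by linarith), abs_of_pos (by linarith)]
      linarith
    · rw [map_mul, Algebra.norm_algebraMap, Rat.cast_mul, abs_mul, mul_pow]
      have hck : (cyclotomicRate k : ℝ) ≤ 1914 := by exact_mod_cast cyclotomicRate_le k
      have hcs : (cyclotomicRate s : ℝ) ≤ 1914 := by exact_mod_cast cyclotomicRate_le s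
      gcongr
      · norm_num
      · refine hNw.trans ?_
        gcongr
        calc _ ≤ (1914 / 1000 : ℝ) * (1914 / 1000) := by gcongr
          _ = _ := by norm_num

end

theorem IntermediateField.adjoin_singleton_eq_top_of_eq {F E : Type*} [Field F] [Field E]
    [Algebra F E] {K : IntermediateField F E} {α : K}
    (h : K = IntermediateField.adjoin F {(α : E)}) : IntermediateField.adjoin F {α} = ⊤ := by
  apply IntermediateField.map_injective K.val
  rw [IntermediateField.adjoin_map, Set.image_singleton, ← AlgHom.fieldRange_eq_map,
    IntermediateField.fieldRange_val]
  exact h.symm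

theorem Real.four_mul_sin_sq_eq (x : ℝ) :
    4 * Real.sin (Real.pi / x) ^ 2 = 2 - 2 * Real.cos (2 * Real.pi / x) := by
  rw [mul_div_assoc, Real.cos_two_mul, Real.cos_sq']
  ring

theorem Real.sixteen_le_sq_mul_four_mul_sin_sq {k : ℕ} (hk : 2 ≤ k) :
    16 ≤ (k : ℝ) ^ 2 * (4 * Real.sin (Real.pi / k) ^ 2) := by
  have hk' : (2 : ℝ) ≤ k := by exact_mod_cast hk
  have h := Real.mul_le_sin (x := Real.pi / k) (by positivity)
    (div_le_div_of_nonneg_left Real.pi_pos.le (by norm_num) hk')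
  have h2 : 2 / Real.pi * (Real.pi / k) = 2 / k := by
    have := Real.pi_ne_zero
    field_simp
  rw [h2, div_le_iff₀ (by positivity)] at h
  nlinarith

theorem Complex.one_sub_exp_mul_one_sub_exp_inv (k : ℕ) :
    (1 - Complex.exp (2 * Real.pi * Complex.I / k)) *
      (1 - (Complex.exp (2 * Real.pi * Complex.I / k))⁻¹) =
      ((2 - 2 * Real.cos (2 * Real.pi / k) : ℝ) : ℂ) := by
  have h := Complex.two_cos (2 * Real.pi / k)
  have hne := Complex.exp_ne_zero (2 * Real.pi * Complex.I / k)
  push_cast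
  rw [h, ← Complex.exp_neg]
  have h1 : (2 * Real.pi / k : ℂ) * Complex.I = 2 * Real.pi * Complex.I / k := by ring
  have h2 : -(2 * Real.pi / k : ℂ) * Complex.I = -(2 * Real.pi * Complex.I / k) := by ring
  rw [h1, h2, Complex.exp_neg]
  field_simp
  ring

/-- **Degree bound for the graphs `Γ₁⁽⁵⁾(14)` with `k ≥ s ≥ 6`.** Let `k ≥ s ≥ 6` be
integers and `K = ℚ(α)` a totally real number field (realized inside `ℝ`) containing
`ℚ(cos(2π/k), cos(2π/s))`, where `α` is an algebraic integer such that for every real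
embedding `σ ≠ id`, `-8 σ(sin²(π/k) sin²(π/s)) < σ(α) ≤ 2 σ(sin²(π/k) sin²(π/s))`,
while `5·2³ < α < 32·14³`.  Then `[K : ℚ] ≤ 909`. -/
theorem degree_bound_pentagon_909
    (k s : ℕ) (hs : 6 ≤ s) (hks : s ≤ k)
    (K : IntermediateField ℚ ℝ) [FiniteDimensional ℚ K]
    (hKtotreal : ∀ σ : K →+* ℂ, ∀ x : K, (σ x).im = 0)
    (hcosk : Real.cos (2 * Real.pi / k) ∈ K)
    (hcoss : Real.cos (2 * Real.pi / s) ∈ K)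
    (α : K) (hαint : IsIntegral ℤ (α : ℝ))
    (hKα : K = IntermediateField.adjoin ℚ {(α : ℝ)})
    (sks : K)
    (hsks : (sks : ℝ) = Real.sin (Real.pi / k) ^ 2 * Real.sin (Real.pi / s) ^ 2)
    (hσ : ∀ σ : K →+* ℝ, σ ≠ algebraMap K ℝ →
      -8 * σ sks < σ α ∧ σ α ≤ 2 * σ sks)
    (hgeo : 5 * 2 ^ 3 < (α : ℝ) ∧ (α : ℝ) < 32 * 14 ^ 3) :
    Module.finrank ℚ K ≤ 909 := by
  have hk : 6 ≤ k := hs.trans hks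
  have : NumberField K := ⟨⟩
  let t : K := ⟨2 - 2 * Real.cos (2 * Real.pi / k),
    sub_mem (ofNat_mem K 2) (mul_mem (ofNat_mem K 2) hcosk)⟩
  let u : K := ⟨2 - 2 * Real.cos (2 * Real.pi / s),
    sub_mem (ofNat_mem K 2) (mul_mem (ofNat_mem K 2) hcoss)⟩
  have htu : (t : ℝ) * u = 16 * sks := by
    change (2 - 2 * Real.cos (2 * Real.pi / k)) * (2 - 2 * Real.cos (2 * Real.pi / s)) =
      16 * (sks : ℝ)
    rw [hsks, ← Real.four_mul_sin_sq_eq, ← Real.four_mul_sin_sq_eq]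
    ring
  have hρtu (ρ : K →+* ℝ) : ρ (t * u) = 16 * ρ sks := by
    have h : t * u = 16 * sks := Subtype.ext htu
    rw [h, map_mul, map_ofNat]
  have hgen : IntermediateField.adjoin ℚ {α} = ⊤ := by
    convert IntermediateField.adjoin_singleton_eq_top_of_eq hKα
      <;> exact Subsingleton.elim _ _
  have hlow (j : ℕ) (hj : 6 ≤ j) := Real.sixteen_le_sq_mul_four_mul_sin_sq (k := j) (by omega)
  refine finrank_le_of_conjugates_le (t := t) (u := u) (α := α) (algebraMap K ℝ) hKtotreal hs hks
    (Complex.isPrimitiveRoot_exp k (by omega)) (Complex.isPrimitiveRoot_exp s (by omega))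
    (Complex.one_sub_exp_mul_one_sub_exp_inv k).symm
    (Complex.one_sub_exp_mul_one_sub_exp_inv s).symm
    ((isIntegral_algebraMap_iff (algebraMap K ℝ).injective).1 hαint) hgen ?_ ?_ ?_ ?_
  · have hsk : (s : ℝ) ≤ k := by exact_mod_cast hks
    have h1 := hlow k hk
    have h2 : 16 ≤ (k : ℝ) ^ 2 * (4 * Real.sin (Real.pi / s) ^ 2) :=
      (hlow s hs).trans (by gcongr)
    rw [hρtu]
    change 256 ≤ (k : ℝ) ^ 4 * (16 * (sks : ℝ))
    rw [hsks]
    nlinarith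
  · rw [hρtu]
    change 16 * (sks : ℝ) ≤ 16
    rw [hsks]
    have := mul_le_one₀ (Real.sin_sq_le_one (Real.pi / k)) (sq_nonneg _)
      (Real.sin_sq_le_one (Real.pi / s))
    linarith
  · intro ρ hρ
    have := hσ ρ hρ
    rw [hρtu]
    constructor <;> linarith
  · change 40 < (α : ℝ) ∧ (α : ℝ) < 87808
    norm_num at hgeo
    exact hgeo
end
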